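/- Let K be a real closed differential field with field of constants k, k ≠ K, and let A ∈ Mat_n(K). Then any two real Picard–Vessiot fields for y′ = Ay over K are isomorphic as differential field extensions of K. -/

import Mathlib

/-- A derivation on a field `F`. -/
structure FieldDeriv (F : Type) [Field F] : Type where
  d : F → F
  map_add : ∀ a b : F, d (a + b) = d a + d b
  leibniz : ∀ a b : F, d (a * b) = a * d b + d a * b

/-- A field is (formally) real if `-1` is not a sum of squares. -/
def IsFormallyRealField (F : Type) [Field F] : Prop :=
  ¬ IsSumSq (-1 : F)

/-- A field is real closed if it is real and no proper algebraic extension of it is real. -/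
def IsRealClosedField (F : Type) [Field F] : Prop :=
  IsFormallyRealField F ∧
    ∀ (E : Type) [Field E] [Algebra F E], Algebra.IsAlgebraic F E →
      IsFormallyRealField E → Function.Surjective (algebraMap F E)

/-- `L/K`, with derivations `dL` extending `dK`, is a Picard--Vessiot field for `y' = A y`. -/
def IsPicardVessiot {K L : Type} [Field K] [Field L] [Algebra K L]
    (dK : FieldDeriv K) (dL : FieldDeriv L) {n : ℕ}
    (A : Matrix (Fin n) (Fin n) K) : Prop :=
  (∀ a : K, dL.d (algebraMap K L a) = algebraMap K L (dK.d a)) ∧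
  ∃ F : Matrix (Fin n) (Fin n) L, IsUnit F.det ∧
    (∀ i j, dL.d (F i j) = (A.map (algebraMap K L) * F) i j) ∧
    IntermediateField.adjoin K (Set.range fun q : Fin n × Fin n => F q.1 q.2) = ⊤ ∧
    ∀ x : L, dL.d x = 0 → ∃ a : K, dK.d a = 0 ∧ algebraMap K L a = x

section

open Polynomial

namespace IsSumSq

theorem inv {F : Type*} [Field F] {s : F} (hs : IsSumSq s) : IsSumSq s⁻¹ := by
  rcases eq_or_ne s 0 with rfl | h
  · simp
  · have : s⁻¹ = s * (s⁻¹ * s⁻¹) := by field_simp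
    rw [this]
    exact hs.mul (.mul_self _)

theorem map_ringHom {R S : Type*} [CommRing R] [CommRing S] (f : R →+* S) {s : R}
    (hs : IsSumSq s) : IsSumSq (f s) := by
  induction hs with
  | zero => simp
  | sq_add a _ ih => simpa using IsSumSq.sq_add _ ih

end IsSumSq

namespace IsFormallyRealField

variable {F : Type} [Field F]

theorem of_ringHom {E : Type} [Field E] (f : F →+* E) (hE : IsFormallyRealField E) :
    IsFormallyRealField F := fun h => hE (by simpa using h.map_ringHom f)

theorem eq_zero_of_isSumSq_neg (hF : IsFormallyRealField F) {s : F} (hs : IsSumSq s)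
    (hs' : IsSumSq (-s)) : s = 0 := by
  by_contra h
  refine hF ?_
  have : (-1 : F) = s⁻¹ * (-s) := by field_simp
  rw [this]
  exact hs.inv.mul hs'

theorem eq_zero_of_add_eq_zero (hF : IsFormallyRealField F) {s t : F} (hs : IsSumSq s)
    (ht : IsSumSq t) (h : s + t = 0) : s = 0 :=
  hF.eq_zero_of_isSumSq_neg hs (by rwa [← eq_neg_of_add_eq_zero_right h])

theorem charZero (hF : IsFormallyRealField F) : CharZero F :=
  have : IsSemireal F := isSemireal_iff_not_isSumSq_neg_one.mpr hF
  inferInstance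

theorem isSumSq_polynomial (hF : IsFormallyRealField F) {p : F[X]} (hp : IsSumSq p) :
    Even p.natDegree ∧ IsSumSq p.leadingCoeff := by
  induction hp with
  | zero => simp
  | @sq_add g p _ ih =>
    rcases eq_or_ne g 0 with rfl | hg
    · simpa using ih
    rcases eq_or_ne p 0 with rfl | hp
    · simp only [add_zero, natDegree_mul hg hg, leadingCoeff_mul]
      exact ⟨⟨_, rfl⟩, .mul_self _⟩
    have hgg : (g * g) ≠ 0 := mul_ne_zero hg hg
    have hE : Even (g * g).natDegree := by rw [natDegree_mul hg hg]; exact ⟨_, rfl⟩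
    have hS : IsSumSq (g * g).leadingCoeff := by rw [leadingCoeff_mul]; exact .mul_self _
    rcases lt_trichotomy (g * g).degree p.degree with h | h | h
    · rw [leadingCoeff_add_of_degree_lt h,
        natDegree_add_eq_right_of_natDegree_lt (natDegree_lt_natDegree hgg h)]
      exact ih
    · have hne : (g * g).leadingCoeff + p.leadingCoeff ≠ 0 := fun h0 =>
        hgg (leadingCoeff_eq_zero.mp (hF.eq_zero_of_add_eq_zero hS ih.2 h0))
      rw [leadingCoeff_add_of_degree_eq h hne]
      refine ⟨?_, hS.add ih.2⟩
      have := degree_add_eq_of_leadingCoeff_add_ne_zero hne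
      rw [h, max_self] at this
      rw [natDegree_eq_of_degree_eq this]
      exact ih.1
    · rw [leadingCoeff_add_of_degree_lt' h,
        natDegree_add_eq_left_of_natDegree_lt (natDegree_lt_natDegree hp h)]
      exact ⟨hE, hS⟩

theorem adjoinRoot_of_odd (hF : IsFormallyRealField F) {f : F[X]} [Fact (Irreducible f)]
    (hodd : Odd f.natDegree) : IsFormallyRealField (AdjoinRoot f) := by
  obtain ⟨n, hn⟩ : ∃ n, f.natDegree = n := ⟨_, rfl⟩
  induction n using Nat.strong_induction_on generalizing f with
  | _ n ih =>
    have hirr : Irreducible f := Fact.out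
    intro h
    have key : ∀ s : AdjoinRoot f, IsSumSq s →
        ∃ p : F[X], AdjoinRoot.mk f p = s ∧ IsSumSq p ∧ p.natDegree ≤ 2 * (n - 1) := by
      intro s hs
      induction hs with
      | zero => exact ⟨0, by simp, .zero, by simp⟩
      | @sq_add a s _ ihs =>
        obtain ⟨p, rfl, hp, hpd⟩ := ihs
        obtain ⟨g, rfl⟩ := AdjoinRoot.mk_surjective a
        have hgd : (g % f).natDegree ≤ n - 1 := by
          have := natDegree_mod_lt g (q := f) (by rintro h0; simp [h0] at hodd)
          omega
        refine ⟨(g % f) * (g % f) + p, ?_, hp.sq_add _, ?_⟩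
        · have : AdjoinRoot.mk f (g % f) = AdjoinRoot.mk f g := by
            rw [AdjoinRoot.mk_eq_mk]
            exact ⟨-(g / f), by linear_combination EuclideanDomain.mod_add_div g f⟩
          simp [this]
        · refine (natDegree_add_le _ _).trans (max_le (natDegree_mul_le.trans ?_) hpd)
          omega
    obtain ⟨p, hp1, hp, hpd⟩ := key _ h
    have hq : IsSumSq (1 * 1 + p) := hp.sq_add 1
    have hlead := hF.isSumSq_polynomial hq
    have hne : (1 * 1 + p) ≠ 0 := by
      intro h0
      have h2 : IsSumSq (-1 : F[X]) := by
        rw [show (-1 : F[X]) = p by linear_combination -h0]; exact hp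
      have := (hF.isSumSq_polynomial h2).2
      exact hF (by simpa using this)
    have hdvd : f ∣ 1 * 1 + p := by
      rw [← AdjoinRoot.mk_eq_zero]; simp [hp1]
    obtain ⟨q, hq'⟩ := hdvd
    have hq0 : q ≠ 0 := by rintro rfl; simp at hq'; simp [hq'] at hne
    have hd : (1 * 1 + p).natDegree ≤ 2 * (n - 1) := by
      refine (natDegree_add_le _ _).trans (max_le ?_ hpd)
      simp
    rw [hq', natDegree_mul hirr.ne_zero hq0] at hd
    have hqe := hlead.1
    rw [hq', natDegree_mul hirr.ne_zero hq0] at hqe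
    have hqodd : Odd q.natDegree := by
      by_contra hc
      rw [Nat.not_odd_iff_even] at hc
      exact (Nat.not_even_iff_odd.mpr (hodd.add_even hc)) hqe
    have hlt : q.natDegree < n := by
      have : 0 < n := hn ▸ hodd.pos
      omega
    obtain ⟨h1, hh1, hh1o, hh1d⟩ : ∃ h1 : F[X], Irreducible h1 ∧ Odd h1.natDegree ∧ h1 ∣ q := by
      clear hlt hq' hd hqe
      induction q using WfDvdMonoid.induction_on_irreducible with
      | zero => exact absurd rfl hq0
      | unit u hu => simp [natDegree_eq_zero_of_isUnit hu] at hqodd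
      | mul a i ha hi iha =>
        rw [natDegree_mul hi.ne_zero ha] at hqodd
        rcases Nat.even_or_odd i.natDegree with he | ho
        · have := iha ha (by
            by_contra hc
            rw [Nat.not_odd_iff_even] at hc
            exact (Nat.not_even_iff_odd.mpr hqodd) (he.add hc))
          obtain ⟨h1, x, y, z⟩ := this
          exact ⟨h1, x, y, z.mul_left _⟩
        · exact ⟨i, hi, ho, dvd_mul_right _ _⟩
    have : Fact (Irreducible h1) := ⟨hh1⟩
    refine ih h1.natDegree ((natDegree_le_of_dvd hh1d hq0).trans_lt hlt) hh1o rfl ?_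
    have hz : AdjoinRoot.mk h1 (1 * 1 + p) = 0 := by
      rw [AdjoinRoot.mk_eq_zero, hq']; exact hh1d.mul_left _
    have : (-1 : AdjoinRoot h1) = AdjoinRoot.mk h1 p := by
      rw [map_add, mul_one, map_one] at hz
      linear_combination -hz
    rw [this]
    exact hp.map_ringHom _

end IsFormallyRealField

namespace IsRealClosedField

variable {R : Type} [Field R]

theorem isSumSq_neg_of_not_isSquare (hR : IsRealClosedField R) {x : R} (hx : ¬ IsSquare x) :
    IsSumSq (-x) := by
  have : Fact (∀ r : R, r ^ 2 ≠ x + 0 * r) := ⟨fun r hr => hx ⟨r, by linear_combination -hr⟩⟩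
  have hnot : ¬ IsFormallyRealField (QuadraticAlgebra R x 0) := by
    intro h
    have : Module.Finite R (QuadraticAlgebra R x 0) := inferInstance
    obtain ⟨r, hr⟩ := hR.2 (QuadraticAlgebra R x 0) inferInstance h ⟨0, 1⟩
    simpa using congrArg QuadraticAlgebra.im hr
  have key : ∀ z : QuadraticAlgebra R x 0, IsSumSq z →
      ∃ s u : R, IsSumSq s ∧ IsSumSq u ∧ z.re = s + x * u := by
    intro z hz
    induction hz with
    | zero => exact ⟨0, 0, .zero, .zero, by simp⟩
    | @sq_add a z _ ih =>
      obtain ⟨s, u, hs, hu, h⟩ := ih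
      refine ⟨a.re * a.re + s, a.im * a.im + u, hs.sq_add _, hu.sq_add _, ?_⟩
      simp [h]
      ring
  obtain ⟨s, u, hs, hu, h⟩ := key _ (not_not.mp hnot)
  have h' : -1 = s + x * u := by simpa [QuadraticAlgebra.re_one] using h
  have hu0 : u ≠ 0 := by
    rintro rfl
    exact hR.1 (by rw [h']; simpa using hs)
  have : -x = (1 * 1 + s) * u⁻¹ := by
    field_simp
    linear_combination h'
  rw [this]
  exact (hs.sq_add 1).mul hu.inv

theorem isSquare_of_isSumSq (hR : IsRealClosedField R) {x : R} (hx : IsSumSq x) :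
    IsSquare x := by
  by_contra h
  have := hR.1.eq_zero_of_isSumSq_neg hx (hR.isSumSq_neg_of_not_isSquare h)
  exact h (by simp [this])

theorem isSquare_or_isSquare_neg (hR : IsRealClosedField R) (x : R) :
    IsSquare x ∨ IsSquare (-x) := by
  by_cases h : IsSquare x
  · exact .inl h
  · exact .inr (hR.isSquare_of_isSumSq (hR.isSumSq_neg_of_not_isSquare h))

/-- The linear order on a real closed field whose nonnegative elements are the squares. -/
theorem exists_linearOrder (hR : IsRealClosedField R) :
    ∃ _ : LinearOrder R, IsStrictOrderedRing R := by
  classical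
  let C : RingCone R :=
    { carrier := {x | IsSumSq x}
      mul_mem' := fun ha hb => IsSumSq.mul ha hb
      one_mem' := .one
      add_mem' := fun ha hb => IsSumSq.add ha hb
      zero_mem' := .zero
      eq_zero_of_mem_of_neg_mem' := fun ha hb => hR.1.eq_zero_of_isSumSq_neg ha hb }
  have : HasMemOrNegMem C :=
    ⟨fun a => (hR.isSquare_or_isSquare_neg a).imp (fun h => h.isSumSq) (fun h => h.isSumSq)⟩
  let : LinearOrder R := .mkOfAddGroupCone C
  have : IsOrderedRing R := .mkOfCone C
  exact ⟨inferInstance, IsOrderedRing.toIsStrictOrderedRing R⟩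

theorem finrank_eq_one_of_odd (hR : IsRealClosedField R) (E : Type) [Field E] [Algebra R E]
    [FiniteDimensional R E] (h : Odd (Module.finrank R E)) : Module.finrank R E = 1 := by
  have := hR.1.charZero
  obtain ⟨y, hy⟩ := Field.exists_primitive_element R E
  have hintegral : IsIntegral R y := .of_finite R y
  have hd : (minpoly R y).natDegree = Module.finrank R E := by
    rw [← IntermediateField.adjoin.finrank hintegral, hy, IntermediateField.finrank_top']
  have : Fact (Irreducible (minpoly R y)) := ⟨minpoly.irreducible hintegral⟩
  have hreal := hR.1.adjoinRoot_of_odd (f := minpoly R y) (hd ▸ h)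
  have : Module.Finite R (AdjoinRoot (minpoly R y)) :=
    (AdjoinRoot.powerBasis (minpoly.ne_zero hintegral)).finite
  have hsurj := hR.2 (AdjoinRoot (minpoly R y)) inferInstance hreal
  obtain ⟨r, hr⟩ := hsurj (AdjoinRoot.root _)
  have h1 : AdjoinRoot.mk (minpoly R y) (X - C r) = 0 := by
    rw [map_sub, AdjoinRoot.mk_X, AdjoinRoot.mk_C, ← hr]
    simp [AdjoinRoot.algebraMap_eq]
  rw [AdjoinRoot.mk_eq_zero] at h1
  have := natDegree_le_of_dvd h1 (X_sub_C_ne_zero r)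
  rw [natDegree_X_sub_C, hd] at this
  have := h.pos
  omega

end IsRealClosedField

namespace IsRealClosedField

variable {R : Type} [Field R]

theorem isSquare_add_mul_of_mul_self_eq_neg_one (hR : IsRealClosedField R) {E : Type} [Field E]
    [Algebra R E] {I : E} (hI : I * I = -1) (a b : R) :
    IsSquare (algebraMap R E a + algebraMap R E b * I) := by
  have := hR.1.charZero
  have hsq : ∀ c : R, IsSquare (algebraMap R E c) := by
    intro c
    rcases hR.isSquare_or_isSquare_neg c with ⟨r, hr⟩ | ⟨r, hr⟩
    · exact ⟨algebraMap R E r, by rw [← map_mul, hr]⟩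
    · refine ⟨algebraMap R E r * I, ?_⟩
      have h : algebraMap R E (-c) = algebraMap R E r * algebraMap R E r := by
        rw [← map_mul, hr]
      rw [map_neg] at h
      linear_combination -h - algebraMap R E r ^ 2 * hI
  rcases eq_or_ne b 0 with rfl | hb
  · simpa using hsq a
  obtain ⟨r, hr⟩ := hR.isSquare_of_isSumSq ((IsSumSq.mul_self b).sq_add a)
  have hmain : ∀ r : R, a * a + b * b = r * r → IsSquare ((a + r) / 2) →
      IsSquare (algebraMap R E a + algebraMap R E b * I) := by
    rintro r hr ⟨x, hx⟩
    have hx0 : x ≠ 0 := by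
      rintro rfl
      have : a = -r := by linear_combination 2 * hx
      rw [this] at hr
      exact hb (by simpa using hr)
    refine ⟨algebraMap R E x + algebraMap R E (b / (2 * x)) * I, ?_⟩
    have h1 : a = x * x - (b / (2 * x)) * (b / (2 * x)) := by
      have h2 : a + r = 2 * (x * x) := by linear_combination 2 * hx
      have h3 : (a - r) * (2 * (x * x)) = -(b * b) := by
        rw [← h2]; linear_combination hr
      field_simp
      linear_combination (4 * x ^ 2 / 2) * h2 + h3
    have h2 : b = 2 * (x * (b / (2 * x))) := by field_simp
    have h1' := congrArg (algebraMap R E) h1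
    have h2' := congrArg (algebraMap R E) h2
    simp only [map_sub, map_mul, map_ofNat] at h1' h2'
    linear_combination h1' + I * h2' - algebraMap R E (b / (2 * x)) ^ 2 * hI
  by_cases h : IsSquare ((a + r) / 2)
  · exact hmain r hr h
  · refine hmain (-r) (by rw [hr]; ring) ?_
    obtain ⟨u, hu⟩ := (hR.isSquare_or_isSquare_neg ((a + r) / 2)).resolve_left h
    have hu0 : u ≠ 0 := by
      rintro rfl
      exact h ⟨0, by linear_combination -hu⟩
    refine ⟨b / (2 * u), ?_⟩
    field_simp
    linear_combination (-2 * (a - r)) * hu - hr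

theorem exists_eq_add_mul_of_mem_adjoin (hR : IsRealClosedField R) {E : Type} [Field E]
    [Algebra R E] {I : E} (hI : I * I = -1) {z : E} (hz : z ∈ IntermediateField.adjoin R {I}) :
    ∃ a b : R, z = algebraMap R E a + algebraMap R E b * I := by
  induction hz using IntermediateField.adjoin_induction with
  | mem x hx => exact ⟨0, 1, by simp [Set.mem_singleton_iff.mp hx]⟩
  | algebraMap x => exact ⟨x, 0, by simp⟩
  | add x y _ _ hx hy =>
    obtain ⟨a, b, rfl⟩ := hx
    obtain ⟨c, d, rfl⟩ := hy
    exact ⟨a + c, b + d, by simp only [map_add]; ring⟩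
  | mul x y _ _ hx hy =>
    obtain ⟨a, b, rfl⟩ := hx
    obtain ⟨c, d, rfl⟩ := hy
    refine ⟨a * c - b * d, a * d + b * c, ?_⟩
    simp only [map_add, map_mul, map_sub]
    linear_combination algebraMap R E b * algebraMap R E d * hI
  | inv x _ hx =>
    obtain ⟨a, b, rfl⟩ := hx
    by_cases h : a * a + b * b = 0
    · have ha := hR.1.eq_zero_of_add_eq_zero (.mul_self a) (.mul_self b) h
      rw [ha, zero_add] at h
      exact ⟨0, 0, by simp [mul_self_eq_zero.mp ha, mul_self_eq_zero.mp h]⟩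
    · have h' : algebraMap R E (a * a + b * b) ≠ 0 := (_root_.map_ne_zero _).mpr h
      refine ⟨a / (a * a + b * b), -b / (a * a + b * b), ?_⟩
      refine inv_eq_of_mul_eq_one_right ?_
      have hq : algebraMap R E (a * a + b * b) = algebraMap R E a * algebraMap R E a +
          algebraMap R E b * algebraMap R E b := by simp only [map_add, map_mul]
      simp only [map_div₀, map_neg]
      generalize algebraMap R E (a * a + b * b) = q at hq h'
      field_simp
      linear_combination (-algebraMap R E b ^ 2) * hI - hq

theorem finrank_adjoin_ne_two (hR : IsRealClosedField R) {E : Type} [Field E]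
    [Algebra R E] {I : E} (hI : I * I = -1) {M : IntermediateField R E}
    (hM : M = IntermediateField.adjoin R {I}) (N : IntermediateField M E) :
    Module.finrank M N ≠ 2 := by
  intro h
  have := hR.1.charZero
  have : CharZero M := charZero_of_injective_algebraMap (algebraMap R M).injective
  have : FiniteDimensional M N := Module.finite_of_finrank_pos (by omega)
  obtain ⟨w, hw⟩ : ∃ w : N, w ∉ (⊥ : IntermediateField M N) := by
    by_contra! hc
    have : (⊥ : IntermediateField M N) = ⊤ := eq_top_iff.mpr fun x _ => hc x
    have h1 := IntermediateField.finrank_eq_one_iff.mpr (rfl : (⊥ : IntermediateField M N) = ⊥)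
    rw [this, IntermediateField.finrank_top'] at h1
    omega
  have hintegral : IsIntegral M w := .of_finite M w
  have hdvd : (minpoly M w).natDegree ≤ 2 := by
    have : Module.Free M N := .of_divisionRing M N
    exact h ▸ minpoly.natDegree_le w
  have hnot1 : (minpoly M w).natDegree ≠ 1 := by
    intro h1
    refine hw ?_
    rw [IntermediateField.mem_bot]
    exact minpoly.natDegree_eq_one_iff.mp h1
  have hpos := minpoly.natDegree_pos hintegral
  have h2 : (minpoly M w).natDegree = 2 := by omega
  set p := minpoly M w
  have hsq : ∃ s, discrim (p.coeff 2) (p.coeff 1) (p.coeff 0) = s * s := by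
    set D : M := discrim (p.coeff 2) (p.coeff 1) (p.coeff 0)
    obtain ⟨a, b, hab⟩ := hR.exists_eq_add_mul_of_mem_adjoin hI (hM.le D.2)
    have hIM : I ∈ M := hM ▸ IntermediateField.mem_adjoin_simple_self R I
    have hI' : (⟨I, hIM⟩ : M) * ⟨I, hIM⟩ = -1 := Subtype.ext hI
    obtain ⟨s, hs⟩ := hR.isSquare_add_mul_of_mul_self_eq_neg_one hI' a b
    refine ⟨s, ?_⟩
    rw [← hs]
    exact Subtype.ext hab
  have hlc : p.coeff 2 ≠ 0 := by
    rw [← h2]; exact leadingCoeff_ne_zero.mpr (minpoly.ne_zero hintegral)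
  obtain ⟨x, hx⟩ := exists_quadratic_eq_zero hlc hsq
  have hroot : p.IsRoot x := by
    rw [IsRoot, eval_eq_sum_range, h2]
    simp only [Finset.sum_range_succ, Finset.sum_range_zero]
    linear_combination hx
  have := natDegree_eq_of_degree_eq_some
    (degree_eq_one_of_irreducible_of_root (minpoly.irreducible hintegral) hroot)
  exact hnot1 this

theorem exists_eq_add_mul_of_isGalois (hR : IsRealClosedField R) {E : Type} [Field E]
    [Algebra R E] [FiniteDimensional R E] [IsGalois R E] {I : E} (hI : I * I = -1) (z : E) :
    ∃ a b : R, z = algebraMap R E a + algebraMap R E b * I := by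
  have hcard : ∃ k, Module.finrank R E = 2 ^ k := by
    have P : Sylow 2 (E ≃ₐ[R] E) := default
    have h1 : Module.finrank R (IntermediateField.fixedField P.toSubgroup) = 1 := by
      refine hR.finrank_eq_one_of_odd _ ?_
      rw [IntermediateField.finrank_eq_fixingSubgroup_index,
        IntermediateField.fixingSubgroup_fixedField, ← Nat.not_even_iff_odd, even_iff_two_dvd]
      exact P.not_dvd_index
    have h2 := Module.finrank_mul_finrank R (IntermediateField.fixedField P.toSubgroup) E
    rw [h1, one_mul, IntermediateField.finrank_fixedField_eq_card] at h2
    obtain ⟨k, hk⟩ := (IsPGroup.iff_card).mp P.isPGroup'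
    exact ⟨k, by rw [← h2, ← hk]⟩
  obtain ⟨k, hk⟩ := hcard
  set M := IntermediateField.adjoin R {I} with hM
  have hdvd : Module.finrank M E ∣ 2 ^ k := by
    rw [← hk, ← Module.finrank_mul_finrank R M E]; exact dvd_mul_left _ _
  obtain ⟨m, -, hm⟩ := (Nat.dvd_prime_pow Nat.prime_two).mp hdvd
  have hm0 : m = 0 := by
    by_contra hne
    obtain ⟨j, rfl⟩ := Nat.exists_eq_succ_of_ne_zero hne
    have hc : Nat.card (E ≃ₐ[M] E) = 2 ^ (j + 1) := by
      rw [IsGalois.card_aut_eq_finrank, hm]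
    obtain ⟨H, hH⟩ := Sylow.exists_subgroup_card_pow_prime (G := E ≃ₐ[M] E) 2 (n := j)
      (by rw [hc]; exact pow_dvd_pow 2 (Nat.le_succ j))
    have h2 := Module.finrank_mul_finrank M (IntermediateField.fixedField H) E
    rw [IntermediateField.finrank_fixedField_eq_card, hH, hm, pow_succ, mul_comm] at h2
    exact hR.finrank_adjoin_ne_two hI hM (IntermediateField.fixedField H)
      (Nat.eq_of_mul_eq_mul_left (by positivity) h2)
  rw [hm0, pow_zero] at hm
  have htop : M = ⊤ := IntermediateField.finrank_eq_one_iff_eq_top.mp hm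
  exact hR.exists_eq_add_mul_of_mem_adjoin hI (by rw [← hM, htop]; exact IntermediateField.mem_top)

theorem exists_eq_add_mul (hR : IsRealClosedField R) {I : AlgebraicClosure R} (hI : I * I = -1)
    (z : AlgebraicClosure R) :
    ∃ a b : R, z = algebraMap R _ a + algebraMap R _ b * I := by
  have := hR.1.charZero
  let N := IntermediateField.adjoin R {z, I}
  have : FiniteDimensional R N :=
    IntermediateField.finiteDimensional_adjoin fun x _ => Algebra.IsIntegral.isIntegral x
  let E := IntermediateField.normalClosure R N (AlgebraicClosure R)
  have hle : N ≤ E := N.le_normalClosure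
  have hz : z ∈ E := hle (IntermediateField.subset_adjoin _ _ (by simp))
  have hI' : I ∈ E := hle (IntermediateField.subset_adjoin _ _ (by simp))
  have : IsGalois R E := { }
  obtain ⟨a, b, h⟩ := hR.exists_eq_add_mul_of_isGalois (E := E) (I := ⟨I, hI'⟩)
    (Subtype.ext hI) ⟨z, hz⟩
  exact ⟨a, b, congrArg Subtype.val h⟩

end IsRealClosedField

/-- Every real field has a real closed extension. -/
theorem IsFormallyRealField.exists_isRealClosedField {F : Type} [Field F]
    (hF : IsFormallyRealField F) :
    ∃ (R : Type) (_ : Field R) (_ : Algebra F R), IsRealClosedField R := by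
  let Ω := AlgebraicClosure F
  obtain ⟨M, hM⟩ : ∃ M : IntermediateField F Ω, 
      Maximal (fun M : IntermediateField F Ω => IsFormallyRealField M) M := by
    have hbot : IsFormallyRealField (⊥ : IntermediateField F Ω) :=
      hF.of_ringHom (IntermediateField.botEquiv F Ω).toRingHom
    obtain ⟨M, -, hM⟩ := zorn_le_nonempty₀ {M : IntermediateField F Ω | IsFormallyRealField M}
      (fun c hc hchain y hy => by
        have : Nonempty c := ⟨⟨y, hy⟩⟩
        have hdir : Directed (· ≤ ·) (fun i : c => (i : IntermediateField F Ω)) :=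
          hchain.directed
        refine ⟨⨆ i : c, (i : IntermediateField F Ω), ?_, fun z hz =>
          le_iSup (fun i : c => (i : IntermediateField F Ω)) ⟨z, hz⟩⟩
        intro h
        have key : ∀ s : (⨆ i : c, (i : IntermediateField F Ω) : IntermediateField F Ω),
            IsSumSq s → ∃ i : c, ∃ t : (i : IntermediateField F Ω), IsSumSq t ∧ (t : Ω) = s := by
          intro s hs
          induction hs with
          | zero => exact ⟨⟨y, hy⟩, 0, .zero, rfl⟩
          | @sq_add a s _ ih =>
            obtain ⟨i, t, ht, hts⟩ := ih
            have ha := a.2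
            rw [← SetLike.mem_coe, IntermediateField.coe_iSup_of_directed hdir] at ha
            obtain ⟨j, hj⟩ := Set.mem_iUnion.mp ha
            obtain ⟨l, hil, hjl⟩ := hdir i j
            refine ⟨l, ⟨a, hjl hj⟩ * ⟨a, hjl hj⟩ + IntermediateField.inclusion hil t,
              (ht.map_ringHom (IntermediateField.inclusion hil).toRingHom).sq_add _, ?_⟩
            simp [hts]
        obtain ⟨i, t, ht, hts⟩ := key _ h
        refine hc i.2 ?_
        rwa [show t = -1 from Subtype.ext (by simpa using hts)] at ht) ⊥ hbot
    exact ⟨M, hM⟩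
  refine ⟨M, inferInstance, inferInstance, hM.prop, fun E _ _ _ hE => ?_⟩
  let f : E →ₐ[M] Ω := IsAlgClosed.lift
  let N : IntermediateField M Ω := f.fieldRange
  have hN : IsFormallyRealField (N.restrictScalars F) :=
    hE.of_ringHom (AlgEquiv.ofInjectiveField f).symm.toRingEquiv.toRingHom
  have hle : M ≤ N.restrictScalars F := fun x hx => N.algebraMap_mem ⟨x, hx⟩
  intro e
  have he : f e ∈ M := hM.le_of_ge hN hle ⟨e, rfl⟩
  exact ⟨⟨f e, he⟩, f.injective (f.commutes ⟨f e, he⟩)⟩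

namespace IsRealClosedField

variable {R : Type} [Field R] [LinearOrder R] [IsStrictOrderedRing R]

theorem exists_eq_C_mul_of_irreducible (hR : IsRealClosedField R) {p : R[X]}
    (hp : Irreducible p) (hroot : ∀ x, ¬ p.IsRoot x) :
    ∃ c u v : R, v ≠ 0 ∧ p * C c = (X - C u) ^ 2 + C (v ^ 2) := by
  obtain ⟨I, hI⟩ : ∃ I : AlgebraicClosure R, I * I = -1 := by
    obtain ⟨I, hI⟩ := IsAlgClosed.exists_pow_nat_eq (-1 : AlgebraicClosure R) two_pos
    exact ⟨I, by rw [← hI, sq]⟩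
  obtain ⟨z, hz⟩ := IsAlgClosed.exists_aeval_eq_zero (AlgebraicClosure R) p
    (degree_pos_of_irreducible hp).ne'
  obtain ⟨u, v, huv⟩ := hR.exists_eq_add_mul hI z
  have hv : v ≠ 0 := by
    rintro rfl
    refine hroot u ?_
    rw [huv, map_zero, zero_mul, add_zero, aeval_algebraMap_apply, map_eq_zero] at hz
    simpa using hz
  have hg : aeval z ((X - C u) ^ 2 + C (v ^ 2)) = 0 := by
    simp only [map_add, map_pow, map_sub, aeval_X, aeval_C, huv]
    linear_combination algebraMap R (AlgebraicClosure R) v ^ 2 * hI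
  have hdvd : p ∣ (X - C u) ^ 2 + C (v ^ 2) :=
    ((minpoly.irreducible (Algebra.IsIntegral.isIntegral z)).associated_of_dvd hp
      (minpoly.dvd R z hz)).symm.dvd.trans (minpoly.dvd R z hg)
  obtain ⟨q, hq⟩ := hdvd
  have hdeg : ((X - C u) ^ 2 + C (v ^ 2)).natDegree = 2 := by
    rw [natDegree_add_C, natDegree_pow, natDegree_X_sub_C]
  have hq0 : q ≠ 0 := by
    rintro rfl
    rw [hq] at hdeg
    simp at hdeg
  rw [hq, natDegree_mul hp.ne_zero hq0] at hdeg
  have h1 : p.natDegree ≠ 1 := fun h => by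
    obtain ⟨x, hx⟩ := exists_root_of_degree_eq_one
      ((degree_eq_iff_natDegree_eq hp.ne_zero).mpr h)
    exact hroot x hx
  have h2 := hp.natDegree_pos
  have h3 : q.natDegree = 0 := by omega
  refine ⟨q.coeff 0, u, v, hv, ?_⟩
  rw [← eq_C_of_natDegree_eq_zero h3, hq]

/-- A polynomial without roots in `[a, b]` has the same sign at `a` and at `b`. -/
theorem eval_mul_eval_pos (hR : IsRealClosedField R) {a b : R} (hab : a ≤ b) {f : R[X]}
    (hf : f ≠ 0) (h : ∀ x, a ≤ x → x ≤ b → ¬ f.IsRoot x) : 0 < f.eval a * f.eval b := by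
  induction f using WfDvdMonoid.induction_on_irreducible with
  | zero => exact absurd rfl hf
  | unit u hu =>
    obtain ⟨c, hc, rfl⟩ := isUnit_iff.mp hu
    simpa using hc.ne_zero
  | mul q p hq hp ih =>
    have hq' := ih hq fun x hax hxb hx => h x hax hxb (by simp [IsRoot.def.mp hx])
    have hp' : ∀ x, a ≤ x → x ≤ b → ¬ p.IsRoot x :=
      fun x hax hxb hx => h x hax hxb (by simp [IsRoot.def.mp hx])
    have hmain : 0 < p.eval a * p.eval b := by
      by_cases hroot : ∃ r, p.IsRoot r
      · obtain ⟨r, hr⟩ := hroot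
        obtain ⟨g, hg⟩ := dvd_iff_isRoot.mpr hr
        obtain ⟨c, hc, rfl⟩ := isUnit_iff.mp
          ((hp.isUnit_or_isUnit hg).resolve_left (not_isUnit_X_sub_C r))
        have hlt : 0 < (a - r) * (b - r) := by
          rcases lt_or_ge r a with h1 | h1
          · exact mul_pos (by linarith) (by linarith)
          · have : b < r := lt_of_not_ge fun h2 => hp' r h1 h2 hr
            exact mul_pos_of_neg_of_neg (by linarith) (by linarith)
        have hc2 := mul_self_pos.mpr hc.ne_zero
        simp only [hg, eval_mul, eval_sub, eval_X, eval_C]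
        calc 0 < ((a - r) * (b - r)) * (c * c) := mul_pos hlt hc2
          _ = _ := by ring
      · obtain ⟨c, u, v, hv, hcuv⟩ := hR.exists_eq_C_mul_of_irreducible hp (by simpa using hroot)
        have hpos : ∀ x, 0 < p.eval x * c := by
          intro x
          have := congrArg (eval x) hcuv
          simp only [eval_mul, eval_C, eval_add, eval_pow, eval_sub, eval_X] at this
          rw [this]
          positivity
        have h1 := mul_pos (hpos a) (hpos b)
        have h2 : p.eval a * c * (p.eval b * c) = (p.eval a * p.eval b) * c ^ 2 := by ring
        rw [h2] at h1
        exact pos_of_mul_pos_left h1 (sq_nonneg c)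
    rw [eval_mul, eval_mul]
    calc 0 < _ := mul_pos hmain hq'
      _ = _ := by ring

end IsRealClosedField

section Sign

variable {R : Type} [Field R] [LinearOrder R] [IsStrictOrderedRing R] {k : Type} [Field k]
  [Algebra k R]

theorem exists_algebraMap_not_separating (t : R) (Z : Finset R)
    (hZ : ∀ z ∈ Z, z ∈ Set.range (algebraMap k R)) (ht : t ∉ Z) :
    ∃ a : k, ∀ z ∈ Z, (z < t ↔ z < algebraMap k R a) ∧ z ≠ algebraMap k R a := by
  classical
  have hcharR : CharZero R := inferInstance
  have hchar : CharZero k := (algebraMap k R).charZero_iff (algebraMap k R).injective |>.mpr hcharR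
  by_cases h1 : (Z.filter (· < t)).Nonempty <;> by_cases h2 : (Z.filter (t < ·)).Nonempty
  · obtain ⟨l, hl⟩ := hZ _ (Finset.mem_filter.mp (Finset.max'_mem _ h1)).1
    obtain ⟨u, hu⟩ := hZ _ (Finset.mem_filter.mp (Finset.min'_mem _ h2)).1
    have hlt := (Finset.mem_filter.mp (Finset.max'_mem _ h1)).2
    have hut := (Finset.mem_filter.mp (Finset.min'_mem _ h2)).2
    rw [← hl] at hlt
    rw [← hu] at hut
    refine ⟨(l + u) / 2, fun z hz => ?_⟩
    simp only [map_div₀, map_add, map_ofNat]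
    rcases lt_trichotomy z t with h | h | h
    · have := Finset.le_max' (Z.filter (· < t)) z (Finset.mem_filter.mpr ⟨hz, h⟩)
      rw [← hl] at this
      have h3 : z < (algebraMap k R l + algebraMap k R u) / 2 := by linarith
      exact ⟨by simp [h, h3], h3.ne⟩
    · exact absurd (h ▸ hz) ht
    · have := Finset.min'_le (Z.filter (t < ·)) z (Finset.mem_filter.mpr ⟨hz, h⟩)
      rw [← hu] at this
      have h3 : (algebraMap k R l + algebraMap k R u) / 2 < z := by linarith
      exact ⟨iff_of_false h.not_gt h3.not_gt, h3.ne'⟩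
  · obtain ⟨l, hl⟩ := hZ _ (Finset.mem_filter.mp (Finset.max'_mem _ h1)).1
    refine ⟨l + 1, fun z hz => ?_⟩
    simp only [map_add, map_one]
    rcases lt_trichotomy z t with h | h | h
    · have := Finset.le_max' (Z.filter (· < t)) z (Finset.mem_filter.mpr ⟨hz, h⟩)
      rw [← hl] at this
      have h3 : z < algebraMap k R l + 1 := by linarith
      exact ⟨by simp [h, h3], h3.ne⟩
    · exact absurd (h ▸ hz) ht
    · exact absurd ⟨z, Finset.mem_filter.mpr ⟨hz, h⟩⟩ h2
  · obtain ⟨u, hu⟩ := hZ _ (Finset.mem_filter.mp (Finset.min'_mem _ h2)).1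
    refine ⟨u - 1, fun z hz => ?_⟩
    simp only [map_sub, map_one]
    rcases lt_trichotomy z t with h | h | h
    · exact absurd ⟨z, Finset.mem_filter.mpr ⟨hz, h⟩⟩ h1
    · exact absurd (h ▸ hz) ht
    · have := Finset.min'_le (Z.filter (t < ·)) z (Finset.mem_filter.mpr ⟨hz, h⟩)
      rw [← hu] at this
      have h3 : algebraMap k R u - 1 < z := by linarith
      exact ⟨iff_of_false h.not_gt h3.not_gt, h3.ne'⟩
  · refine ⟨0, fun z hz => ?_⟩
    rcases lt_trichotomy z t with h | h | h
    · exact absurd ⟨z, Finset.mem_filter.mpr ⟨hz, h⟩⟩ h1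
    · exact absurd (h ▸ hz) ht
    · exact absurd ⟨z, Finset.mem_filter.mpr ⟨hz, h⟩⟩ h2

/-- If `k` is algebraically closed in the real closed field `R` and `t ∈ R` is not in `k`, then
some `a ∈ k` gives prescribed polynomials over `k` the signs they have at `t`. -/
theorem IsRealClosedField.exists_forall_aeval_mul_pos (hR : IsRealClosedField R)
    (hk : ∀ z : R, IsAlgebraic k z → z ∈ Set.range (algebraMap k R)) {t : R}
    (ht : t ∉ Set.range (algebraMap k R)) (s : Finset k[X]) (hs : ∀ h ∈ s, h ≠ 0) :
    ∃ a : k, ∀ h ∈ s, 0 < aeval t h * algebraMap k R (h.eval a) := by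
  classical
  set F : k[X] := ∏ h ∈ s, h with hF
  have hF0 : F ≠ 0 := Finset.prod_ne_zero_iff.mpr hs
  have hmem : ∀ z : R, z ∈ F.rootSet R ↔ aeval z F = 0 := fun z => by
    rw [mem_rootSet]; simp [hF0]
  have hrange : ∀ z : R, aeval z F = 0 → z ∈ Set.range (algebraMap k R) :=
    fun z hz => hk z ⟨F, hF0, hz⟩
  obtain ⟨a, ha⟩ := exists_algebraMap_not_separating (k := k) t (F.rootSet R).toFinset
    (fun z hz => hrange z ((hmem z).mp (by simpa using hz)))
    (fun h => ht (hrange t ((hmem t).mp (by simpa using h))))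
  refine ⟨a, fun h hh => ?_⟩
  have hmap : h.map (algebraMap k R) ≠ 0 :=
    (Polynomial.map_ne_zero_iff (algebraMap k R).injective).mpr (hs h hh)
  have hroot : ∀ x, (h.map (algebraMap k R)).IsRoot x →
      (x < t ↔ x < algebraMap k R a) ∧ x ≠ algebraMap k R a ∧ x ≠ t := by
    intro x hx
    have h0 : aeval x F = 0 := by
      rw [hF, map_prod]
      refine Finset.prod_eq_zero hh ?_
      rwa [IsRoot.def, eval_map_algebraMap] at hx
    have h1 := ha x (by simpa using (hmem x).mpr h0)
    exact ⟨h1.1, h1.2, fun h2 => ht (h2 ▸ hrange x h0)⟩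
  have hev : (h.map (algebraMap k R)).eval (algebraMap k R a) = algebraMap k R (h.eval a) := by
    rw [eval_map, eval₂_hom]
  rw [← hev, ← eval_map_algebraMap]
  rcases le_total t (algebraMap k R a) with hle | hle
  · refine hR.eval_mul_eval_pos hle hmap fun x h1 h2 hx => ?_
    obtain ⟨h3, h4, h5⟩ := hroot x hx
    exact absurd (h3.mpr (lt_of_le_of_ne h2 h4)) (not_lt.mpr h1)
  · rw [mul_comm]
    refine hR.eval_mul_eval_pos hle hmap fun x h1 h2 hx => ?_
    obtain ⟨h3, h4, h5⟩ := hroot x hx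
    exact absurd (h3.mp (lt_of_le_of_ne h2 h5)) (not_lt.mpr h1)

end Sign

section Hermite

variable {R : Type} [Field R] [LinearOrder R] [IsStrictOrderedRing R]

instance fact_sq_ne_neg_one : Fact (∀ r : R, r ^ 2 ≠ -1 + 0 * r) :=
  ⟨fun r h => by nlinarith [sq_nonneg r]⟩

theorem IsRealClosedField.isAlgClosed_quadraticAlgebra (hR : IsRealClosedField R) :
    IsAlgClosed (QuadraticAlgebra R (-1) 0) := by
  let f : QuadraticAlgebra R (-1) 0 →ₐ[R] AlgebraicClosure R := IsAlgClosed.lift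
  have hI : f ⟨0, 1⟩ * f ⟨0, 1⟩ = -1 := by
    rw [← map_mul, ← map_one f, ← map_neg]
    congr 1
    ext <;> simp [QuadraticAlgebra.re_one, QuadraticAlgebra.im_one]
  have hsurj : Function.Surjective f := fun z => by
    obtain ⟨a, b, rfl⟩ := hR.exists_eq_add_mul hI z
    exact ⟨algebraMap _ _ a + algebraMap _ _ b * ⟨0, 1⟩, by
      simp only [map_add, map_mul, f.commutes]⟩
  exact IsAlgClosed.of_ringEquiv _ _
    (RingEquiv.ofBijective f.toRingHom ⟨f.toRingHom.injective, hsurj⟩).symm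

theorem sum_eval_mul_eval_re {n : ℕ} (z : Fin n → QuadraticAlgebra R (-1) 0)
    {H P : Matrix (Fin n) (Fin n) R} {d : Fin n → R}
    (hH : ∀ i j, H i j = (∑ l, z l ^ (i + j : ℕ)).re)
    (hd : P.transpose * H * P = Matrix.diagonal d) (w : Fin n → R) :
    ∑ l, ((∑ j, (P.mulVec w) j • z l ^ (j : ℕ)) * (∑ j, (P.mulVec w) j • z l ^ (j : ℕ))).re =
      ∑ i, d i * w i ^ 2 := by
  have h1 : ∀ v : Fin n → R,
      ∑ l, ((∑ j, v j • z l ^ (j : ℕ)) * (∑ j, v j • z l ^ (j : ℕ))).re =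
        dotProduct v (H.mulVec v) := by
    intro v
    have hre : ∀ {ι : Type} (s : Finset ι) (g : ι → QuadraticAlgebra R (-1) 0),
        (∑ i ∈ s, g i).re = ∑ i ∈ s, (g i).re :=
      fun s g => map_sum (QuadraticAlgebra.reₗ (-1 : R) 0) g s
    simp only [Finset.sum_mul_sum, hre]
    simp only [dotProduct, Matrix.mulVec, hH, hre, Finset.mul_sum, Finset.sum_mul]
    rw [Finset.sum_comm]
    refine Finset.sum_congr rfl fun i _ => ?_
    rw [Finset.sum_comm]
    refine Finset.sum_congr rfl fun j _ => Finset.sum_congr rfl fun l _ => ?_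
    rw [smul_mul_smul_comm, ← pow_add, QuadraticAlgebra.re_smul, smul_eq_mul]
    ring
  rw [h1, ← Matrix.vecMul_transpose, ← Matrix.dotProduct_mulVec, Matrix.mulVec_mulVec,
    Matrix.vecMul_transpose, Matrix.mulVec_mulVec, hd]
  simp only [dotProduct, Matrix.mulVec_diagonal]
  exact Finset.sum_congr rfl fun i _ => by ring

theorem card_le_card_of_hankel_diagonal {n : ℕ} {z : Fin n → QuadraticAlgebra R (-1) 0}
    (hz : Function.Injective z) {H P : Matrix (Fin n) (Fin n) R} {d : Fin n → R}
    (hH : ∀ i j, H i j = (∑ l, z l ^ (i + j : ℕ)).re) (hP : P.det ≠ 0)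
    (hd : P.transpose * H * P = Matrix.diagonal d) (N S : Finset (Fin n))
    (g : QuadraticAlgebra R (-1) 0 →ₗ[R] R) (ε : R) (hN : ∀ i ∈ N, d i * ε ≤ 0)
    (hg : ∀ v : Fin n → R, (∀ l ∈ S, g (∑ j, v j • z l ^ (j : ℕ)) = 0) →
      (∑ l, ((∑ j, v j • z l ^ (j : ℕ)) * (∑ j, v j • z l ^ (j : ℕ))).re) * ε ≤ 0 →
      ∀ l, ∑ j, v j • z l ^ (j : ℕ) = 0) :
    N.card ≤ S.card := by
  classical
  let ext : (N → R) →ₗ[R] (Fin n → R) := Function.ExtendByZero.linearMap R Subtype.val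
  let T : (N → R) →ₗ[R] (S → R) := LinearMap.pi fun l =>
    g.comp ((∑ j : Fin n, (LinearMap.proj j : (Fin n → R) →ₗ[R] R).smulRight (z l ^ (j : ℕ))).comp
      (P.mulVecLin.comp ext))
  have hT : Function.Injective T := by
    rw [← LinearMap.ker_eq_bot, LinearMap.ker_eq_bot']
    intro w hw
    have h0 := hg (P.mulVec (ext w)) (fun l hl => by
      simpa [T, LinearMap.sum_apply] using congrFun hw ⟨l, hl⟩) (by
      rw [sum_eval_mul_eval_re z hH hd, Finset.sum_mul]
      refine Finset.sum_nonpos fun i _ => ?_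
      by_cases hi : i ∈ N
      · have := mul_nonneg_of_nonpos_of_nonpos (hN i hi) (neg_nonpos.mpr (sq_nonneg (ext w i)))
        linarith
      · have : ext w i = 0 := Function.extend_apply' _ _ _ (by simpa using hi)
        simp [this])
    have hv : P.mulVec (ext w) = 0 := by
      have := Matrix.eq_zero_of_forall_index_sum_mul_pow_eq_zero (f := z)
        (v := fun j => algebraMap R (QuadraticAlgebra R (-1) 0) (P.mulVec (ext w) j)) hz
        (fun l => by simpa only [Algebra.smul_def] using h0 l)
      ext j
      simpa using congrFun this j
    have hw0 := Matrix.eq_zero_of_mulVec_eq_zero hP hv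
    ext i
    have := congrFun hw0 i
    rwa [show ext w i = w i from Subtype.val_injective.extend_apply _ _ _] at this
  simpa using LinearMap.finrank_le_finrank_of_injective hT

theorem card_im_pos_eq_card_im_neg {n : ℕ} {z : Fin n → QuadraticAlgebra R (-1) 0}
    (hz : Function.Injective z) (hstar : ∀ l, ∃ l', z l' = star (z l)) :
    (Finset.univ.filter fun l => 0 < (z l).im).card =
      (Finset.univ.filter fun l => (z l).im < 0).card := by
  choose s hs using hstar
  have hinj : Function.Injective s := fun a b h => hz (star_injective (by rw [← hs, ← hs, h]))
  refine le_antisymm (Finset.card_le_card_of_injOn s (fun l hl => ?_) hinj.injOn)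
    (Finset.card_le_card_of_injOn s (fun l hl => ?_) hinj.injOn) <;>
  · simp only [Finset.coe_filter, Finset.mem_univ, true_and, Set.mem_ofPred_eq] at hl ⊢
    rw [hs, QuadraticAlgebra.im_star]
    linarith

theorem exists_im_eq_zero_iff {n : ℕ} {z : Fin n → QuadraticAlgebra R (-1) 0}
    (hz : Function.Injective z) (hstar : ∀ l, ∃ l', z l' = star (z l))
    {H P : Matrix (Fin n) (Fin n) R} {d : Fin n → R}
    (hH : ∀ i j, H i j = (∑ l, z l ^ (i + j : ℕ)).re) (hP : P.det ≠ 0)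
    (hd : P.transpose * H * P = Matrix.diagonal d) :
    (∃ l, (z l).im = 0) ↔ 2 * (Finset.univ.filter fun i => d i ≤ 0).card < n := by
  classical
  have hcard := card_im_pos_eq_card_im_neg hz hstar
  have hsplit : (Finset.univ.filter fun l => 0 < (z l).im).card +
      (Finset.univ.filter fun l => (z l).im < 0).card +
      (Finset.univ.filter fun l => (z l).im = 0).card = n := by
    rw [← Finset.card_union_of_disjoint, ← Finset.card_union_of_disjoint]
    · conv_rhs => rw [← Fintype.card_fin n, ← Finset.card_univ]
      congr 1
      ext l
      rcases lt_trichotomy (z l).im 0 with h | h | h <;> simp [h]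
    · rw [Finset.disjoint_left]
      intro l hl
      simp only [Finset.mem_union, Finset.mem_filter, Finset.mem_univ, true_and] at hl ⊢
      rcases hl with h | h
      · exact h.ne'
      · exact h.ne
    · rw [Finset.disjoint_left]
      intro l hl
      simp only [Finset.mem_filter, Finset.mem_univ, true_and, not_lt] at hl ⊢
      exact hl.le
  have hsplit' : (Finset.univ.filter fun i => d i ≤ 0).card +
      (Finset.univ.filter fun i => ¬ d i ≤ 0).card = n := by
    rw [Finset.card_filter_add_card_filter_not, Finset.card_univ, Fintype.card_fin]
  have hconj : ∀ (v : Fin n → R) (l l' : Fin n), z l' = star (z l) →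
      ∑ j, v j • z l' ^ (j : ℕ) = star (∑ j, v j • z l ^ (j : ℕ)) := by
    intro v l l' h
    rw [star_sum, h]
    refine Finset.sum_congr rfl fun j _ => ?_
    rw [← star_pow]
    ext <;> simp [- star_pow]
  constructor
  · rintro ⟨l, hl⟩
    have hle := card_le_card_of_hankel_diagonal hz hH hP hd (Finset.univ.filter fun i => d i ≤ 0)
      (Finset.univ.filter fun l => 0 < (z l).im) (QuadraticAlgebra.imₗ _ _) 1 (by simp) (by
        intro v hv hle
        have him : ∀ l, (∑ j, v j • z l ^ (j : ℕ)).im = 0 := by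
          intro l
          obtain ⟨l', hl'⟩ := hstar l
          rcases lt_trichotomy (z l).im 0 with h | h | h
          · have h1 := hv l' (by
              simp only [Finset.mem_filter, Finset.mem_univ, true_and, hl',
                QuadraticAlgebra.im_star]
              linarith)
            rw [hconj v l l' hl'] at h1
            change (star _ : QuadraticAlgebra R (-1) 0).im = 0 at h1
            rwa [QuadraticAlgebra.im_star, neg_eq_zero] at h1
          · have h2 : z l' = z l := by
              rw [hl']
              ext <;> simp [h]
            have h1 := congrArg QuadraticAlgebra.im (hconj v l l' hl')
            rw [h2, QuadraticAlgebra.im_star] at h1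
            linarith
          · exact hv l (by simpa using h)
        intro l
        simp only [QuadraticAlgebra.re_mul, him, mul_one, mul_zero, add_zero] at hle
        have h0 : ∀ l ∈ Finset.univ, 0 ≤
            (∑ j, v j • z l ^ (j : ℕ)).re * (∑ j, v j • z l ^ (j : ℕ)).re :=
          fun l _ => mul_self_nonneg _
        have := (Finset.sum_eq_zero_iff_of_nonneg h0).mp
          (le_antisymm hle (Finset.sum_nonneg h0)) l (Finset.mem_univ l)
        ext
        · simpa using this
        · exact him l)
    have : 0 < (Finset.univ.filter fun l => (z l).im = 0).card :=
      Finset.card_pos.mpr ⟨l, by simp [hl]⟩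
    omega
  · intro hlt
    by_contra! hne
    have hle := card_le_card_of_hankel_diagonal hz hH hP hd (Finset.univ.filter fun i => ¬ d i ≤ 0)
      (Finset.univ.filter fun l => 0 < (z l).im) (QuadraticAlgebra.reₗ _ _) (-1)
      (fun i hi => by
        have := (Finset.mem_filter.mp hi).2
        linarith) (by
        intro v hv hle
        have hre : ∀ l, (∑ j, v j • z l ^ (j : ℕ)).re = 0 := by
          intro l
          obtain ⟨l', hl'⟩ := hstar l
          rcases lt_or_gt_of_ne (hne l) with h | h
          · have h1 := hv l' (by
              simp only [Finset.mem_filter, Finset.mem_univ, true_and, hl',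
                QuadraticAlgebra.im_star]
              linarith)
            rw [hconj v l l' hl'] at h1
            change (star _ : QuadraticAlgebra R (-1) 0).re = 0 at h1
            rwa [QuadraticAlgebra.re_star, zero_mul, add_zero] at h1
          · exact hv l (by simpa using h)
        intro l
        simp only [QuadraticAlgebra.re_mul, hre, mul_zero, zero_add, mul_neg, neg_mul,
          one_mul, mul_one, Finset.sum_neg_distrib, neg_neg] at hle
        have h0 : ∀ l ∈ Finset.univ, 0 ≤
            (∑ j, v j • z l ^ (j : ℕ)).im * (∑ j, v j • z l ^ (j : ℕ)).im :=
          fun l _ => mul_self_nonneg _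
        have := (Finset.sum_eq_zero_iff_of_nonneg h0).mp
          (le_antisymm hle (Finset.sum_nonneg h0)) l (Finset.mem_univ l)
        ext
        · exact hre l
        · simpa using this)
    have : (Finset.univ.filter fun l => (z l).im = 0).card = 0 := by
      simpa [Finset.card_eq_zero, Finset.filter_eq_empty_iff] using hne
    omega

end Hermite

/-- The power sums of the roots of a monic polynomial, as universal expressions in its
coefficients. -/
theorem Polynomial.exists_psum_roots {A : Type} [CommRing A] (f : A[X]) {n : ℕ} (m : ℕ) :
    ∃ p : A, ∀ (L : Type) [Field L] (φ : A →+* L) (z : Fin n → L),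
      f.map φ = ∏ i, (X - C (z i)) → φ p = ∑ i, z i ^ m := by
  obtain ⟨Q, hQ⟩ := MvPolynomial.esymmAlgHom_fin_surjective ℤ (le_refl n)
    ⟨MvPolynomial.psum (Fin n) ℤ m, MvPolynomial.psum_isSymmetric (Fin n) ℤ m⟩
  have hQ' := congrArg Subtype.val hQ
  rw [MvPolynomial.esymmAlgHom_apply] at hQ'
  refine ⟨MvPolynomial.aeval (fun i : Fin n => (-1) ^ (i + 1 : ℕ) * f.coeff (n - (i + 1))) Q,
    fun L _ φ z hz => ?_⟩
  have h1 := congrArg (MvPolynomial.aeval z) hQ'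
  have hpsum : MvPolynomial.aeval z (MvPolynomial.psum (Fin n) ℤ m) = ∑ i, z i ^ m := by
    simp [MvPolynomial.psum]
  rw [hpsum] at h1
  have h2 := MvPolynomial.comp_aeval_apply (fun i : Fin n => MvPolynomial.esymm (Fin n) ℤ (i + 1))
    (MvPolynomial.aeval z) Q
  have h3 := MvPolynomial.comp_aeval_apply
    (fun i : Fin n => (-1) ^ (i + 1 : ℕ) * f.coeff (n - (i + 1))) φ.toIntAlgHom Q
  rw [← h1, h2]
  refine h3.trans ?_
  congr 2
  ext i
  have hV := Multiset.prod_X_sub_C_coeff (Finset.univ.val.map z) (k := n - (i + 1)) (by simp)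
  rw [Multiset.map_map, Multiset.card_map, Finset.card_val, Finset.card_univ, Fintype.card_fin,
    Nat.sub_sub_self (show (i + 1 : ℕ) ≤ n from i.2)] at hV
  have hc : φ (f.coeff (n - (i + 1))) =
      (-1) ^ (i + 1 : ℕ) * (Finset.univ.val.map z).esymm (i + 1) := by
    rw [← coeff_map, hz, ← hV]
    rfl
  rw [MvPolynomial.aeval_esymm_eq_multiset_esymm]
  simp only [RingHom.toIntAlgHom_apply, map_mul, map_pow, map_neg, map_one, hc]
  rw [← mul_assoc, ← mul_pow]
  simp

theorem Matrix.IsSymm.exists_transpose_mul_mul_eq_diagonal {F : Type} [Field F] [CharZero F]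
    {n : ℕ}
    {H : Matrix (Fin n) (Fin n) F} (hH : H.IsSymm) :
    ∃ (P : Matrix (Fin n) (Fin n) F) (d : Fin n → F), P.det ≠ 0 ∧
      P.transpose * H * P = Matrix.diagonal d := by
  have : Invertible (2 : F) := invertibleOfNonzero two_ne_zero
  have hsymm : LinearMap.IsSymm (Matrix.toBilin' H) := by
    refine (LinearMap.BilinForm.isSymm_iff).1 ?_
    rw [← Matrix.toBilin_basisFun]
    exact (Matrix.isSymm_toBilin_iff_isSymm _).2 hH
  obtain ⟨v', hv'⟩ := LinearMap.BilinForm.exists_orthogonal_basis hsymm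
  have hfin : Module.finrank F (Fin n → F) = n := by simp
  let v := v'.reindex (finCongr hfin)
  have hv : ∀ i j, i ≠ j → Matrix.toBilin' H (v i) (v j) = 0 := by
    intro i j hij
    simp only [v, Module.Basis.reindex_apply]
    exact hv' ((finCongr hfin).symm.injective.ne hij)
  let P : Matrix (Fin n) (Fin n) F := Matrix.of fun i j => v j i
  have hent : ∀ i j, (P.transpose * H * P) i j = Matrix.toBilin' H (v i) (v j) := by
    intro i j
    rw [Matrix.toBilin'_apply', Matrix.mul_assoc, Matrix.mul_apply']
    simp only [P, dotProduct, Matrix.mulVec, Matrix.mul_apply, Matrix.transpose_apply,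
      Matrix.of_apply]
  refine ⟨P, fun i => (P.transpose * H * P) i i, ?_, ?_⟩
  · have hli : LinearIndependent F P.col := v.linearIndependent
    rw [Matrix.linearIndependent_cols_iff_isUnit] at hli
    exact ((Matrix.isUnit_iff_isUnit_det _).1 hli).ne_zero
  · ext i j
    by_cases hij : i = j
    · subst hij
      simp
    · rw [Matrix.diagonal_apply_ne _ hij, hent, hv i j hij]

theorem Matrix.IsSymm.exists_transpose_mul_mul_eq_diagonal_of_isDomain {A : Type} [CommRing A]
    [IsDomain A] [CharZero A] {n : ℕ} {H : Matrix (Fin n) (Fin n) A} (hH : H.IsSymm) :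
    ∃ (P : Matrix (Fin n) (Fin n) A) (d : Fin n → A), P.det ≠ 0 ∧
      P.transpose * H * P = Matrix.diagonal d := by
  have : CharZero (FractionRing A) :=
    charZero_of_injective_algebraMap (IsFractionRing.injective A (FractionRing A))
  obtain ⟨Q, e, hQ, hQe⟩ :=
    (hH.map (algebraMap A (FractionRing A))).exists_transpose_mul_mul_eq_diagonal
  obtain ⟨⟨b, hb⟩, hbQ⟩ := IsLocalization.exist_integer_multiples_of_finite (nonZeroDivisors A)
    (fun q : Fin n × Fin n => Q q.1 q.2)
  choose P hP using hbQ
  have hPQ : (Matrix.of fun i j => P (i, j)).map (algebraMap A (FractionRing A)) =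
      algebraMap A (FractionRing A) b • Q := by
    ext i j
    simpa [Algebra.smul_def] using hP (i, j)
  have hinj := IsFractionRing.injective A (FractionRing A)
  have hb0 : algebraMap A (FractionRing A) b ≠ 0 := by
    simpa using nonZeroDivisors.ne_zero hb
  set P' : Matrix (Fin n) (Fin n) A := Matrix.of fun i j => P (i, j)
  have hmap : (P'.transpose * H * P').map (algebraMap A (FractionRing A)) =
      (algebraMap A (FractionRing A) b ^ 2) • Matrix.diagonal e := by
    rw [Matrix.map_mul, Matrix.map_mul, Matrix.transpose_map, hPQ, ← hQe]
    simp only [Matrix.transpose_smul, Matrix.smul_mul, Matrix.mul_smul, smul_smul, sq]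
  refine ⟨P', fun i => (P'.transpose * H * P') i i, ?_, ?_⟩
  · intro h0
    have := congrArg (algebraMap A (FractionRing A)) h0
    rw [RingHom.map_det, RingHom.mapMatrix_apply, hPQ, Matrix.det_smul, map_zero] at this
    exact mul_ne_zero (pow_ne_zero _ hb0) hQ this
  · ext i j
    by_cases hij : i = j
    · subst hij
      simp
    · rw [Matrix.diagonal_apply_ne _ hij]
      apply hinj
      have := congrFun (congrFun hmap i) j
      rw [Matrix.map_apply] at this
      rw [this, Matrix.smul_apply, Matrix.diagonal_apply_ne _ hij, smul_zero, map_zero]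

theorem Polynomial.Monic.exists_eq_prod_X_sub_C {L : Type} [Field L] [IsAlgClosed L] {f : L[X]}
    (hf : f.Monic) {n : ℕ} (hn : f.natDegree = n) :
    ∃ z : Fin n → L, f = ∏ i, (X - C (z i)) := by
  have hs := IsAlgClosed.splits f
  have hlen : f.roots.toList.length = n := by
    rw [Multiset.length_toList, ← hn, hs.natDegree_eq_card_roots]
  refine ⟨fun i => f.roots.toList.get (i.cast hlen.symm), ?_⟩
  subst hlen
  conv_lhs => rw [hs.eq_prod_roots_of_monic hf, ← Multiset.coe_toList f.roots]
  rw [Multiset.map_coe, Multiset.prod_coe, ← List.prod_ofFn]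
  congr 1
  apply List.ext_get <;> simp

section HankelCount

variable {R : Type} [Field R] [LinearOrder R] [IsStrictOrderedRing R]

/-- The number of sign conditions on the diagonalised Hankel form detects real roots. -/
theorem IsRealClosedField.exists_eval₂_eq_zero_iff (hR : IsRealClosedField R) {A : Type}
    [CommRing A] {f : A[X]} (hf : f.Monic) {n : ℕ} (hn : f.natDegree = n)
    {H P : Matrix (Fin n) (Fin n) A} {d : Fin n → A}
    (hH : ∀ i j, ∀ (L : Type) [Field L] (φ : A →+* L) (z : Fin n → L),
      f.map φ = ∏ l, (X - C (z l)) → φ (H i j) = ∑ l, z l ^ (i + j : ℕ))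
    (hd : P.transpose * H * P = Matrix.diagonal d) (φ : A →+* R) (hP : φ P.det ≠ 0)
    (hsep : (∀ i, φ (d i) ≠ 0) ∨ (f.map φ).Separable) :
    (∀ i, φ (d i) ≠ 0) ∧
    ((∃ b : R, eval₂ φ b f = 0) ↔ 2 * (Finset.univ.filter fun i => φ (d i) ≤ 0).card < n) := by
  have := hR.isAlgClosed_quadraticAlgebra
  let ι : R →+* QuadraticAlgebra R (-1) 0 := algebraMap R (QuadraticAlgebra R (-1) 0)
  have hfm : (f.map (ι.comp φ)).Monic := hf.map _
  obtain ⟨z, hz⟩ := hfm.exists_eq_prod_X_sub_C (n := n) (by rw [hf.natDegree_map, hn])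
  have hHz : ∀ i j, ι (φ (H i j)) = ∑ l, z l ^ (i + j : ℕ) := fun i j =>
    hH i j _ (ι.comp φ) z hz
  have hdφ : (P.map φ).transpose * H.map φ * P.map φ = Matrix.diagonal fun i => φ (d i) := by
    rw [← Matrix.transpose_map, ← Matrix.map_mul, ← Matrix.map_mul, hd, Matrix.diagonal_map]
    exact map_zero φ
  have hPdet : (P.map φ).det ≠ 0 := by
    rwa [← RingHom.mapMatrix_apply, ← RingHom.map_det]
  have hV : (H.map φ).map ι = (Matrix.vandermonde z).transpose * Matrix.vandermonde z := by
    ext1 i j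
    rw [Matrix.map_apply, Matrix.map_apply, hHz]
    simp [Matrix.mul_apply, Matrix.vandermonde_apply, pow_add]
  have hdetH : ι (H.map φ).det = (Matrix.vandermonde z).det ^ 2 := by
    rw [RingHom.map_det, RingHom.mapMatrix_apply, hV, Matrix.det_mul, Matrix.det_transpose, sq]
  have hdet : (P.map φ).det * (H.map φ).det * (P.map φ).det = ∏ i, φ (d i) := by
    rw [← Matrix.det_diagonal, ← hdφ, Matrix.det_mul, Matrix.det_mul, Matrix.det_transpose]
  have hinj : Function.Injective z := by
    rcases hsep with h | h
    · rw [← Matrix.det_vandermonde_ne_zero_iff]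
      intro h0
      rw [h0, zero_pow two_ne_zero, map_eq_zero_iff ι ι.injective] at hdetH
      rw [hdetH, mul_zero, zero_mul] at hdet
      exact Finset.prod_ne_zero_iff.2 (fun i _ => h i) hdet.symm
    · have h2 : (f.map (ι.comp φ)).Separable := by
        rw [← Polynomial.map_map]
        exact h.map
      rw [hz, separable_prod_X_sub_C_iff] at h2
      exact h2
  have hdne : ∀ i, φ (d i) ≠ 0 := by
    have h1 : (H.map φ).det ≠ 0 := by
      intro h0
      rw [h0, map_zero] at hdetH
      exact Matrix.det_vandermonde_ne_zero_iff.2 hinj (pow_eq_zero_iff two_ne_zero |>.1 hdetH.symm)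
    have h2 := mul_ne_zero (mul_ne_zero hPdet h1) hPdet
    rw [hdet, Finset.prod_ne_zero_iff] at h2
    exact fun i => h2 i (Finset.mem_univ i)
  refine ⟨hdne, ?_⟩
  have hroot : ∀ x, eval₂ (ι.comp φ) x f = 0 ↔ ∃ l, z l = x := by
    intro x
    rw [← eval_map, hz, eval_prod, Finset.prod_eq_zero_iff]
    simp only [eval_sub, eval_X, eval_C, Finset.mem_univ, true_and, sub_eq_zero, eq_comm]
  have hιstar : ∀ r : R, star (ι r) = ι r := fun r => by
    ext <;> simp [ι]
  have hstar : ∀ l, ∃ l', z l' = star (z l) := by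
    intro l
    rw [← hroot]
    have h1 := (hroot (z l)).2 ⟨l, rfl⟩
    have h2 := congrArg (starRingEnd (QuadraticAlgebra R (-1) 0)) h1
    rw [hom_eval₂, map_zero] at h2
    have h3 : (starRingEnd (QuadraticAlgebra R (-1) 0)).comp (ι.comp φ) = ι.comp φ := by
      ext1 a
      exact hιstar (φ a)
    rw [h3] at h2
    exact h2
  rw [← exists_im_eq_zero_iff hinj hstar (fun i j => ?_) hPdet hdφ]
  · constructor
    · rintro ⟨b, hb⟩
      have h1 : eval₂ (ι.comp φ) (ι b) f = 0 := by rw [← hom_eval₂, hb, map_zero]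
      obtain ⟨l, hl⟩ := (hroot _).1 h1
      exact ⟨l, by simp [hl, ι]⟩
    · rintro ⟨l, hl⟩
      refine ⟨(z l).re, ι.injective ?_⟩
      rw [hom_eval₂, map_zero, hroot]
      refine ⟨l, ?_⟩
      ext <;> simp [ι, hl]
  · rw [Matrix.map_apply, ← hHz]
    simp [ι]

end HankelCount

theorem MvPolynomial.exists_clear_denominators {A ι : Type} [CommRing A] (δ : ι → A)
    (G : ι → A[X]) (P : MvPolynomial ι A) :
    ∃ D ∈ Submonoid.closure (Set.range δ), ∃ Q : A[X], ∀ (S : Type) [CommRing S] (ψ : A →+* S)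
      (y : S) (x : ι → S), (∀ j, ψ (δ j) * x j = Polynomial.eval₂ ψ y (G j)) →
        ψ D * P.eval₂ ψ x = Polynomial.eval₂ ψ y Q := by
  induction P using MvPolynomial.induction_on with
  | C a => exact ⟨1, one_mem _, Polynomial.C a, fun S _ ψ y x _ => by simp⟩
  | add p q hp hq =>
    obtain ⟨D, hD, Q, hQ⟩ := hp
    obtain ⟨D', hD', Q', hQ'⟩ := hq
    refine ⟨D * D', mul_mem hD hD', Polynomial.C D' * Q + Polynomial.C D * Q',
      fun S _ ψ y x h => ?_⟩
    have h1 := hQ S ψ y x h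
    have h2 := hQ' S ψ y x h
    simp only [MvPolynomial.eval₂_add, map_mul, Polynomial.eval₂_add,
      Polynomial.eval₂_mul, Polynomial.eval₂_C, ← h1, ← h2]
    ring
  | mul_X p i hp =>
    obtain ⟨D, hD, Q, hQ⟩ := hp
    refine ⟨D * δ i, mul_mem hD (Submonoid.subset_closure ⟨i, rfl⟩), Q * G i,
      fun S _ ψ y x h => ?_⟩
    have h1 := hQ S ψ y x h
    simp only [MvPolynomial.eval₂_mul, MvPolynomial.eval₂_X, map_mul, Polynomial.eval₂_mul,
      ← h1, ← h i]
    ring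

theorem exists_isIntegral_forall_eq_aeval (A F : Type) {R ι : Type} [CommRing A] [IsDomain A]
    [Field F]
    [Algebra A F] [IsFractionRing A F] [Field R] [CharZero F] [Algebra A R] [Algebra F R]
    [IsScalarTower A F R] [Finite ι] (x : ι → R) (hx : ∀ j, IsAlgebraic A (x j)) :
    ∃ y : R, IsIntegral A y ∧ ∃ g : ι → F[X], ∀ j, x j = aeval y (g j) := by
  have hFinj := IsFractionRing.injective A F
  have hxF : ∀ j, IsIntegral F (x j) := fun j =>
    ((hx j).extendScalars hFinj).isIntegral
  let E := IntermediateField.adjoin F (Set.range x)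
  have : FiniteDimensional F E :=
    IntermediateField.finiteDimensional_adjoin (by rintro _ ⟨j, rfl⟩; exact hxF j)
  obtain ⟨y₀, hy₀⟩ := Field.exists_primitive_element F E
  have halg : IsAlgebraic F (y₀ : R) :=
    (Algebra.IsAlgebraic.isAlgebraic (R := F) y₀).algebraMap
  obtain ⟨c, hc0, hcy⟩ := ((IsFractionRing.isAlgebraic_iff A F R).2 halg).exists_integral_multiple
  have hc0' : algebraMap A F c ≠ 0 := fun h0 => hc0 (hFinj (h0.trans (map_zero _).symm))
  have hmem : ∀ j, ∃ g : F[X], aeval (y₀ : R) g = x j := by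
    intro j
    have h1 : (⟨x j, IntermediateField.subset_adjoin F _ ⟨j, rfl⟩⟩ : E) ∈
        IntermediateField.adjoin F {y₀} := by
      rw [hy₀]
      trivial
    rw [← IntermediateField.mem_toSubalgebra,
      IntermediateField.adjoin_simple_toSubalgebra_of_isAlgebraic
        (Algebra.IsAlgebraic.isAlgebraic (R := F) y₀),
        Algebra.adjoin_singleton_eq_range_aeval] at h1
    obtain ⟨g, hg⟩ := h1
    refine ⟨g, ?_⟩
    have h2 := congrArg (algebraMap E R) hg
    rw [AlgHom.toRingHom_eq_coe, RingHom.coe_coe, ← aeval_algebraMap_apply] at h2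
    exact h2
  choose g hg using hmem
  refine ⟨c • (y₀ : R), hcy, fun j => (g j).comp (C (algebraMap A F c)⁻¹ * X), fun j => ?_⟩
  rw [aeval_comp, map_mul, aeval_C, aeval_X, ← hg j]
  congr 2
  rw [← algebraMap_smul F c (y₀ : R), Algebra.smul_def, ← mul_assoc, ← map_mul,
    inv_mul_cancel₀ hc0', map_one, one_mul]

theorem MvPolynomial.eval₂_aeval {k B S σ τ : Type} [CommRing k] [CommRing B] [CommRing S]
    [Algebra k B] (ψ : B →+* S) (c : τ → S) (v : σ → MvPolynomial τ B) {w : σ → S}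
    (hw : ∀ i, (v i).eval₂ ψ c = w i) (P : MvPolynomial σ k) :
    (MvPolynomial.aeval v P).eval₂ ψ c = P.eval₂ (ψ.comp (algebraMap k B)) w := by
  obtain rfl : (fun i => (v i).eval₂ ψ c) = w := _root_.funext hw
  have h := MvPolynomial.map_aeval v (MvPolynomial.eval₂Hom ψ c) P
  have h2 : (MvPolynomial.eval₂Hom ψ c).comp (algebraMap k (MvPolynomial τ B)) =
      ψ.comp (algebraMap k B) := by
    refine RingHom.ext fun r => ?_
    rw [RingHom.comp_apply, MvPolynomial.algebraMap_apply, MvPolynomial.coe_eval₂Hom,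
      MvPolynomial.eval₂_C, RingHom.comp_apply]
  rw [h2] at h
  exact h

theorem MvPolynomial.eval_eq_eval₂_id {k σ : Type} [CommRing k] (a : σ → k)
    (P : MvPolynomial σ k) : MvPolynomial.eval a P = P.eval₂ (RingHom.id k) a :=
  rfl

section Curve

variable {R : Type} [Field R] [LinearOrder R] [IsStrictOrderedRing R]

theorem IsRealClosedField.exists_root_specialization (hR : IsRealClosedField R) {k A : Type}
    [Field k] [Algebra k R] (hk : ∀ z : R, IsAlgebraic k z → z ∈ Set.range (algebraMap k R))
    [CommRing A] [IsDomain A] [Algebra A R] (hinj : Function.Injective (algebraMap A R))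
    {f : A[X]} (hf : f.Monic) (hsep : (f.map (algebraMap A R)).Separable) {y : R}
    (hy : aeval y f = 0) :
    ∃ s : Finset A, (∀ h ∈ s, h ≠ 0) ∧ ∀ ψ : A →+* k,
      (∀ h ∈ s, 0 < algebraMap A R h * algebraMap k R (ψ h)) → ∃ b : k, eval₂ ψ b f = 0 := by
  classical
  have : CharZero A := (algebraMap A R).charZero
  choose p hp using fun m => f.exists_psum_roots (n := f.natDegree) m
  let H : Matrix (Fin f.natDegree) (Fin f.natDegree) A := Matrix.of fun i j => p (i + j)
  have hHs : H.IsSymm := by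
    ext i j
    simp [H, add_comm]
  obtain ⟨P, d, hP, hd⟩ := hHs.exists_transpose_mul_mul_eq_diagonal_of_isDomain
  have hH : ∀ i j, ∀ (L : Type) [Field L] (φ : A →+* L) (z : Fin f.natDegree → L),
      f.map φ = ∏ l, (X - C (z l)) → φ (H i j) = ∑ l, z l ^ (i + j : ℕ) :=
    fun i j L _ φ z hz => hp _ L φ z hz
  have hne : ∀ {a : A}, a ≠ 0 → algebraMap A R a ≠ 0 := fun ha h0 =>
    ha (hinj (h0.trans (map_zero _).symm))
  obtain ⟨hd0, hiff⟩ := hR.exists_eval₂_eq_zero_iff hf rfl hH hd (algebraMap A R) (hne hP)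
    (Or.inr hsep)
  refine ⟨insert P.det (Finset.univ.image d), ?_, fun ψ hψ => ?_⟩
  · intro h hh
    rw [Finset.mem_insert, Finset.mem_image] at hh
    rcases hh with rfl | ⟨i, -, rfl⟩
    · exact hP
    · exact fun h0 => hd0 i (by rw [h0, map_zero])
  · let φ : A →+* R := (algebraMap k R).comp ψ
    have hψd : ∀ i, 0 < algebraMap A R (d i) * φ (d i) := fun i =>
      hψ _ (Finset.mem_insert_of_mem (Finset.mem_image_of_mem _ (Finset.mem_univ i)))
    have hψP : φ P.det ≠ 0 := right_ne_zero_of_mul (hψ _ (Finset.mem_insert_self _ _)).ne'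
    obtain ⟨-, hiff'⟩ := hR.exists_eval₂_eq_zero_iff hf rfl hH hd φ hψP
      (Or.inl fun i => right_ne_zero_of_mul (hψd i).ne')
    have hfilter : (Finset.univ.filter fun i => algebraMap A R (d i) ≤ 0) =
        Finset.univ.filter fun i => φ (d i) ≤ 0 := by
      ext i
      simp only [Finset.mem_filter, Finset.mem_univ, true_and]
      have := hψd i
      rcases pos_and_pos_or_neg_and_neg_of_mul_pos this with h | h
      · exact ⟨fun h' => absurd h.1 h'.not_gt, fun h' => absurd h.2 h'.not_gt⟩
      · exact ⟨fun _ => h.2.le, fun _ => h.1.le⟩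
    have hlt := hiff.1 ⟨y, hy⟩
    rw [hfilter] at hlt
    obtain ⟨b, hb⟩ := hiff'.2 hlt
    have hb' : eval₂ (algebraMap k R) b (f.map ψ) = 0 := by
      rwa [eval₂_map]
    obtain ⟨b0, rfl⟩ := hk b ⟨f.map ψ, (hf.map ψ).ne_zero, hb'⟩
    refine ⟨b0, (algebraMap k R).injective ?_⟩
    rw [hom_eval₂, map_zero]
    exact hb

theorem IsRealClosedField.exists_point_specialization (hR : IsRealClosedField R) {k A ι : Type}
    [Field k] [Algebra k R] (hk : ∀ z : R, IsAlgebraic k z → z ∈ Set.range (algebraMap k R))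
    [CommRing A] [IsDomain A] [IsIntegrallyClosed A] [Algebra A R]
    (hinj : Function.Injective (algebraMap A R)) [Finite ι]
    (x : ι → R) (hx : ∀ j, IsAlgebraic A (x j)) :
    ∃ s : Finset A, (∀ h ∈ s, h ≠ 0) ∧ ∀ ψ : A →+* k,
      (∀ h ∈ s, 0 < algebraMap A R h * algebraMap k R (ψ h)) →
        ∃ c : ι → k, ∀ P : MvPolynomial ι A, MvPolynomial.aeval x P = 0 →
          P.eval₂ ψ c = 0 := by
  classical
  have := Fintype.ofFinite ι
  have : FaithfulSMul A R := (faithfulSMul_iff_algebraMap_injective A R).2 hinj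
  have : CharZero A := (algebraMap A R).charZero
  let F := FractionRing A
  let _ : Algebra F R := FractionRing.liftAlgebra A R
  have : IsScalarTower A F R := FractionRing.isScalarTower_liftAlgebra A R
  have : CharZero F := charZero_of_injective_algebraMap (IsFractionRing.injective A F)
  obtain ⟨y, hy, g, hg⟩ := exists_isIntegral_forall_eq_aeval A F x hx
  have hsep : ((minpoly A y).map (algebraMap A R)).Separable := by
    have h1 := (minpoly.irreducible (hy.tower_top (A := F))).separable
    rw [minpoly.isIntegrallyClosed_eq_field_fractions' F hy] at h1
    have h2 := h1.map (f := algebraMap F R)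
    rwa [Polynomial.map_map, ← IsScalarTower.algebraMap_eq] at h2
  obtain ⟨s, hs0, hs⟩ := hR.exists_root_specialization hk hinj (minpoly.monic hy) hsep
    (minpoly.aeval A y)
  choose δ hδ0 hδ using fun j =>
    IsLocalization.integerNormalization_spec (nonZeroDivisors A) (g j)
  let G : ι → A[X] := fun j => IsLocalization.integerNormalization (nonZeroDivisors A) (g j)
  have hG : ∀ j, algebraMap A R (δ j) * x j = eval₂ (algebraMap A R) y (G j) := by
    intro j
    have h1 := congrArg (aeval y) (hδ j)
    rw [aeval_map_algebraMap, ← algebraMap_smul F (δ j) (g j), map_smul, ← hg j,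
      algebraMap_smul, Algebra.smul_def] at h1
    exact h1.symm
  refine ⟨s ∪ Finset.univ.image fun j => δ j, ?_, fun ψ hψ => ?_⟩
  · intro h hh
    rw [Finset.mem_union, Finset.mem_image] at hh
    rcases hh with hh | ⟨j, -, rfl⟩
    · exact hs0 h hh
    · exact nonZeroDivisors.ne_zero (hδ0 j)
  · obtain ⟨b, hb⟩ := hs ψ fun h hh => hψ h (Finset.mem_union_left _ hh)
    have hψδ : ∀ j, ψ (δ j) ≠ 0 := by
      intro j h0
      have h1 := hψ _ (Finset.mem_union_right _ (Finset.mem_image_of_mem _ (Finset.mem_univ j)))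
      rw [h0, map_zero, mul_zero] at h1
      exact h1.false
    refine ⟨fun j => (ψ (δ j))⁻¹ * eval₂ ψ b (G j), fun P hP => ?_⟩
    obtain ⟨D, hD, Q, hQ⟩ := P.exists_clear_denominators (fun j => δ j) G
    have h1 := hQ R (algebraMap A R) y x hG
    rw [← MvPolynomial.aeval_def, hP, mul_zero] at h1
    obtain ⟨q, rfl⟩ := minpoly.isIntegrallyClosed_dvd hy (p := Q) h1.symm
    have h2 := hQ k ψ b (fun j => (ψ (δ j))⁻¹ * eval₂ ψ b (G j)) fun j =>
      mul_inv_cancel_left₀ (hψδ j) _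
    rw [eval₂_mul, hb, zero_mul, mul_eq_zero] at h2
    refine h2.resolve_left ?_
    have hle : Submonoid.closure (Set.range fun j => δ j) ≤
        (nonZeroDivisors k).comap (ψ : A →* k) := by
      rw [Submonoid.closure_le]
      rintro _ ⟨j, rfl⟩
      exact mem_nonZeroDivisors_of_ne_zero (hψδ j)
    exact nonZeroDivisors.ne_zero (hle hD)

theorem IsRealClosedField.exists_point_fin (hR : IsRealClosedField R) {m : ℕ} :
    ∀ {k : Type} [Field k] [Algebra k R],
      (∀ z : R, IsAlgebraic k z → z ∈ Set.range (algebraMap k R)) → ∀ x : Fin m → R,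
        ∃ a : Fin m → k, ∀ P : MvPolynomial (Fin m) k,
          MvPolynomial.aeval x P = 0 → MvPolynomial.eval a P = 0 := by
  induction m with
  | zero =>
    intro k _ _ _ x
    refine ⟨Fin.elim0, fun P hP => (algebraMap k R).injective ?_⟩
    rw [map_zero, ← hP, MvPolynomial.aeval_def, ← MvPolynomial.eval₂_id,
      MvPolynomial.hom_eval₂]
    congr 1
    exact funext fun i => i.elim0
  | succ m ih =>
    intro k _ _ hk x
    by_cases ht : x 0 ∈ Set.range (algebraMap k R)
    · obtain ⟨t, ht⟩ := ht
      obtain ⟨a, ha⟩ := ih hk (Fin.tail x)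
      refine ⟨Fin.cons t a, fun P hP => ?_⟩
      let v : Fin (m + 1) → MvPolynomial (Fin m) k :=
        Fin.cons (MvPolynomial.C t) MvPolynomial.X
      have h1 := ha (MvPolynomial.aeval v P) (by
        rw [← hP, MvPolynomial.aeval_def, MvPolynomial.eval₂_aeval _ _ _ (w := x)]
        · rfl
        · refine Fin.cases ?_ fun j => ?_
          · simp [v, ht]
          · simp [v, Fin.tail])
      rw [MvPolynomial.eval_eq_eval₂_id,
        MvPolynomial.eval₂_aeval _ _ _ (w := Fin.cons t a)] at h1
      · exact h1
      · refine Fin.cases ?_ fun j => ?_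
        · simp [v]
        · simp [v]
    · have htr : Transcendental k (x 0) := fun h => ht (hk _ h)
      let _ : Algebra k[X] R := (aeval (x 0)).toRingHom.toAlgebra
      have hmap : ∀ p : k[X], algebraMap k[X] R p = aeval (x 0) p := fun _ => rfl
      have : IsScalarTower k k[X] R := IsScalarTower.of_algebraMap_eq fun r => by
        rw [hmap, Polynomial.algebraMap_apply, Algebra.algebraMap_self_apply, aeval_C]
      have hinj : Function.Injective (algebraMap k[X] R) :=
        transcendental_iff_injective.1 htr
      have : FaithfulSMul k[X] R := (faithfulSMul_iff_algebraMap_injective _ _).2 hinj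
      let F := FractionRing k[X]
      let _ : Algebra F R := FractionRing.liftAlgebra k[X] R
      have : IsScalarTower k[X] F R := FractionRing.isScalarTower_liftAlgebra k[X] R
      let k' := algebraicClosure F R
      obtain ⟨b, hb⟩ := ih (k := k') (fun z hz => ⟨⟨z, by
        have h2 : IsIntegral F z := isIntegral_trans (A := k') z hz.isIntegral
        exact mem_algebraicClosure_iff.2 h2.isAlgebraic⟩, rfl⟩) (Fin.tail x)
      let y : Fin m → R := fun i => b i
      have hbx : ∀ P : MvPolynomial (Fin (m + 1)) k, MvPolynomial.aeval x P = 0 →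
          MvPolynomial.aeval (Fin.cons (x 0) y : Fin (m + 1) → R) P = 0 := by
        intro P hP
        let t : k' := algebraMap F k' (algebraMap k[X] F X)
        have htx : algebraMap k' R t = x 0 := by
          rw [← IsScalarTower.algebraMap_apply F k' R, ← IsScalarTower.algebraMap_apply k[X] F R,
            hmap, aeval_X]
        let _ : Algebra k k' :=
          ((algebraMap F k').comp ((algebraMap k[X] F).comp (algebraMap k k[X]))).toAlgebra
        have hkk' : (algebraMap k' R).comp (algebraMap k k') = algebraMap k R := by
          ext r
          change algebraMap k' R (algebraMap F k' (algebraMap k[X] F (algebraMap k k[X] r))) = _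
          rw [← IsScalarTower.algebraMap_apply F k' R, ← IsScalarTower.algebraMap_apply k[X] F R,
            ← IsScalarTower.algebraMap_apply k k[X] R]
        let v : Fin (m + 1) → MvPolynomial (Fin m) k' :=
          Fin.cons (MvPolynomial.C t) MvPolynomial.X
        have h1 := hb (MvPolynomial.aeval v P) (by
          rw [← hP, MvPolynomial.aeval_def, MvPolynomial.eval₂_aeval _ _ _ (w := x), hkk']
          · rfl
          · refine Fin.cases ?_ fun j => ?_
            · simp [v, htx]
            · simp [v, Fin.tail])
        have h2 := congrArg (algebraMap k' R) h1
        rw [MvPolynomial.eval_eq_eval₂_id, MvPolynomial.hom_eval₂, map_zero, RingHom.comp_id,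
          MvPolynomial.eval₂_aeval _ _ _ (w := Fin.cons (x 0) y), hkk'] at h2
        · exact h2
        · refine Fin.cases ?_ fun j => ?_
          · simp [v, htx]
          · simp [v, y]
      obtain ⟨s, hs0, hs⟩ := hR.exists_point_specialization hk hinj y fun j =>
        (IsFractionRing.isAlgebraic_iff k[X] F R).2 (b j).2.isAlgebraic
      obtain ⟨a, ha⟩ := hR.exists_forall_aeval_mul_pos hk ht s hs0
      obtain ⟨c, hc⟩ := hs (evalRingHom a) ha
      refine ⟨Fin.cons a c, fun P hP => ?_⟩
      let v : Fin (m + 1) → MvPolynomial (Fin m) k[X] :=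
        Fin.cons (MvPolynomial.C X) MvPolynomial.X
      have h1 := hc (MvPolynomial.aeval v P) (by
        rw [← hbx P hP, MvPolynomial.aeval_def,
          MvPolynomial.eval₂_aeval _ _ _ (w := Fin.cons (x 0) y),
          ← IsScalarTower.algebraMap_eq k k[X] R]
        · rfl
        · refine Fin.cases ?_ fun j => ?_
          · simp [v, hmap]
          · simp [v, y])
      rw [MvPolynomial.eval₂_aeval _ _ _ (w := Fin.cons a c)] at h1
      · have h2 : (evalRingHom a).comp (algebraMap k k[X]) = RingHom.id k := by
          ext r
          simp
        rwa [h2] at h1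
      · refine Fin.cases ?_ fun j => ?_
        · simp [v]
        · simp [v]

/-- The Artin--Lang theorem: a point over a real closed field specialises to a relatively
algebraically closed subfield, away from a given hypersurface. -/
theorem IsRealClosedField.exists_point (hR : IsRealClosedField R) {k ι : Type} [Field k]
    [Algebra k R] (hk : ∀ z : R, IsAlgebraic k z → z ∈ Set.range (algebraMap k R)) [Finite ι]
    (x : ι → R) (g : MvPolynomial ι k) (hg : MvPolynomial.aeval x g ≠ 0) :
    ∃ a : ι → k, MvPolynomial.eval a g ≠ 0 ∧ ∀ P : MvPolynomial ι k,
      MvPolynomial.aeval x P = 0 → MvPolynomial.eval a P = 0 := by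
  obtain ⟨m, ⟨e⟩⟩ := Finite.exists_equiv_fin (Option ι)
  let x' : Option ι → R := fun o => o.elim (MvPolynomial.aeval x g)⁻¹ x
  obtain ⟨b, hb⟩ := hR.exists_point_fin hk (x' ∘ e.symm)
  have hb' : ∀ P : MvPolynomial (Option ι) k, MvPolynomial.aeval x' P = 0 →
      MvPolynomial.eval (b ∘ e) P = 0 := by
    intro P hP
    rw [← MvPolynomial.eval_rename]
    refine hb _ ?_
    rw [MvPolynomial.aeval_rename, Function.comp_assoc, e.symm_comp_self, Function.comp_id, hP]
  refine ⟨fun i => b (e (some i)), fun h0 => ?_, fun P hP => ?_⟩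
  · have h1 := hb' (MvPolynomial.rename some g * MvPolynomial.X none - 1) (by
      rw [map_sub, map_mul, MvPolynomial.aeval_rename, MvPolynomial.aeval_X, map_one, sub_eq_zero]
      exact mul_inv_cancel₀ hg)
    rw [map_sub, map_mul, MvPolynomial.eval_rename, map_one] at h1
    have h2 : MvPolynomial.eval ((b ∘ e) ∘ some) g = 0 := h0
    rw [h2, zero_mul, zero_sub, neg_eq_zero] at h1
    exact one_ne_zero h1
  · have h1 := hb' (MvPolynomial.rename some P) (by
      rw [MvPolynomial.aeval_rename]
      exact hP)
    rw [MvPolynomial.eval_rename] at h1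
    exact h1

end Curve

/-- A `FieldDeriv` as a bundled derivation. -/
def FieldDeriv.toDerivation {F : Type} [Field F] (d : FieldDeriv F) : Derivation ℤ F F :=
  Derivation.mk' (AddMonoidHom.mk' d.d d.map_add).toIntLinearMap fun a b => by
    simp [d.leibniz, mul_comm]

@[simp]
theorem FieldDeriv.toDerivation_apply {F : Type} [Field F] (d : FieldDeriv F) (x : F) :
    d.toDerivation x = d.d x :=
  rfl

/-- The field of constants. -/
def FieldDeriv.constants {F : Type} [Field F] (d : FieldDeriv F) : Subfield F where
  carrier := {x | d.d x = 0}
  mul_mem' {a b} ha hb := by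
    rw [Set.mem_ofPred_eq] at *
    rw [d.leibniz, ha, hb, mul_zero, zero_mul, add_zero]
  one_mem' := d.toDerivation.map_one_eq_zero
  add_mem' {a b} ha hb := by
    rw [Set.mem_ofPred_eq] at *
    rw [d.map_add, ha, hb, add_zero]
  zero_mem' := map_zero d.toDerivation
  neg_mem' {a} ha := by
    have h : d.toDerivation a = 0 := ha
    exact (map_neg d.toDerivation a).trans (by rw [h, neg_zero])
  inv_mem' a ha := by
    have h : d.toDerivation a = 0 := ha
    exact (d.toDerivation.leibniz_inv a).trans (by rw [h, smul_zero])

theorem FieldDeriv.mem_constants_of_isAlgebraic {F : Type} [Field F] [CharZero F]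
    (d : FieldDeriv F) {x : F} (hx : IsAlgebraic d.constants x) : x ∈ d.constants := by
  have hsep := (minpoly.irreducible hx.isIntegral).separable
  have h1 := hsep.aeval_derivative_ne_zero (minpoly.aeval d.constants x)
  have h2 : ∀ p : d.constants[X], d.d (aeval x p) = aeval x (derivative p) * d.d x := by
    intro p
    induction p using Polynomial.induction_on' with
    | add p q hp hq =>
      rw [_root_.map_add, d.map_add, hp, hq, derivative_add, _root_.map_add, add_mul]
    | monomial m a =>
      have ha : d.toDerivation a = 0 := a.2
      have h3 : d.toDerivation ((a : F) * x ^ m) = (a : F) * (m * x ^ (m - 1)) * d.d x := by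
        rw [Derivation.leibniz, ha, Derivation.leibniz_pow]
        simp
        ring
      rw [aeval_monomial, derivative_monomial, aeval_monomial]
      refine h3.trans ?_
      rw [map_mul, map_natCast]
      change _ = (a : F) * m * x ^ (m - 1) * d.d x
      ring
  have h3 := h2 (minpoly d.constants x)
  rw [minpoly.aeval] at h3
  exact (mul_eq_zero.1 (h3.symm.trans (map_zero d.toDerivation))).resolve_left h1

theorem IsRealClosedField.mem_range_of_isAlgebraic {K R : Type} [Field K] [Field R] [Algebra K R]
    (hK : IsRealClosedField K) (hR : IsFormallyRealField R) {z : R} (hz : IsAlgebraic K z) :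
    z ∈ Set.range (algebraMap K R) := by
  have h := hK.2 (algebraicClosure K R) inferInstance
    (hR.of_ringHom (algebraMap (algebraicClosure K R) R))
  obtain ⟨a, ha⟩ := h ⟨z, mem_algebraicClosure_iff.2 hz⟩
  exact ⟨a, congrArg Subtype.val ha⟩

theorem IsRealClosedField.mem_range_constants_of_isAlgebraic {K R : Type} [Field K] [CharZero K]
    [Field R] [Algebra K R] (hK : IsRealClosedField K) (hR : IsFormallyRealField R)
    (d : FieldDeriv K) {z : R} (hz : IsAlgebraic d.constants z) :
    z ∈ Set.range (algebraMap d.constants R) := by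
  obtain ⟨a, rfl⟩ := hK.mem_range_of_isAlgebraic hR (hz.tower_top K)
  have ha := d.mem_constants_of_isAlgebraic
    ((isAlgebraic_algebraMap_iff (algebraMap K R).injective).1 hz)
  exact ⟨⟨a, ha⟩, rfl⟩

/-- A linear form vanishing on the elements with constant coefficients of a differentially stable
space of polynomials vanishes on the whole space. -/
theorem Derivation.eq_zero_of_forall_coeff_eq_zero {L σ : Type} [Field L] (D : Derivation ℤ L L)
    {J : Submodule L (MvPolynomial σ L)}
    (hJ : ∀ u ∈ J, ∃ u' ∈ J, ∀ m, MvPolynomial.coeff m u' = D (MvPolynomial.coeff m u))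
    (E : MvPolynomial σ L →ₗ[L] L)
    (hE : ∀ u ∈ J, (∀ m, D (MvPolynomial.coeff m u) = 0) → E u = 0) :
    ∀ w ∈ J, E w = 0 := by
  classical
  intro w
  induction hN : w.support.card using Nat.strong_induction_on generalizing w with
  | _ N ih =>
  intro hw
  by_cases hw0 : w = 0
  · rw [hw0, map_zero]
  let T : Set (MvPolynomial σ L) := {u | u ∈ J ∧ u ≠ 0 ∧ u.support ⊆ w.support}
  obtain ⟨u, ⟨huJ, hu0, huw⟩, humin⟩ :
      ∃ u ∈ T, ∀ v ∈ T, u.support.card ≤ v.support.card := by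
    obtain ⟨u, hu, hmin⟩ := (measure fun u : MvPolynomial σ L => u.support.card).wf.has_min T
      ⟨w, hw, hw0, subset_rfl⟩
    exact ⟨u, hu, fun v hv => not_lt.1 (hmin v hv)⟩
  obtain ⟨m, hm⟩ := MvPolynomial.support_nonempty.2 hu0
  have hm0 : MvPolynomial.coeff m u ≠ 0 := MvPolynomial.mem_support_iff.1 hm
  let v := (MvPolynomial.coeff m u)⁻¹ • u
  have hvJ : v ∈ J := J.smul_mem _ huJ
  have hv1 : MvPolynomial.coeff m v = 1 := by
    rw [MvPolynomial.coeff_smul, smul_eq_mul, inv_mul_cancel₀ hm0]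
  have hvu : ∀ i, MvPolynomial.coeff i u = 0 → MvPolynomial.coeff i v = 0 := fun i hi => by
    rw [MvPolynomial.coeff_smul, hi, smul_zero]
  obtain ⟨v', hv'J, hv'⟩ := hJ v hvJ
  have hv'u : v'.support ⊆ u.support.erase m := by
    intro i hi
    rw [MvPolynomial.mem_support_iff, hv'] at hi
    rw [Finset.mem_erase, MvPolynomial.mem_support_iff]
    refine ⟨?_, fun h0 => hi (by rw [hvu i h0, map_zero])⟩
    rintro rfl
    rw [hv1, D.map_one_eq_zero] at hi
    exact hi rfl
  have hv'0 : v' = 0 := by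
    by_contra h0
    have h1 := humin v' ⟨hv'J, h0, hv'u.trans ((Finset.erase_subset _ _).trans huw)⟩
    exact absurd (h1.trans (Finset.card_le_card hv'u)) (Finset.card_erase_lt_of_mem hm).not_ge
  have hEv : E v = 0 := hE v hvJ fun i => by rw [← hv', hv'0, MvPolynomial.coeff_zero]
  let w' := w - MvPolynomial.coeff m w • v
  have hw'w : w'.support ⊆ w.support.erase m := by
    intro i hi
    rw [MvPolynomial.mem_support_iff, MvPolynomial.coeff_sub, MvPolynomial.coeff_smul] at hi
    rw [Finset.mem_erase]
    refine ⟨?_, ?_⟩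
    · rintro rfl
      rw [hv1, smul_eq_mul, mul_one, sub_self] at hi
      exact hi rfl
    · by_contra hiw
      have hiu : MvPolynomial.coeff i u = 0 :=
        MvPolynomial.notMem_support_iff.1 fun h => hiw (huw h)
      rw [MvPolynomial.notMem_support_iff.1 hiw, hvu i hiu, smul_zero, sub_zero] at hi
      exact hi rfl
  have h1 := ih w'.support.card (hN ▸ (Finset.card_le_card hw'w).trans_lt
    (Finset.card_erase_lt_of_mem (huw hm))) w' rfl (J.sub_mem hw (J.smul_mem _ hvJ))
  rwa [_root_.map_sub, _root_.map_smul, hEv, smul_zero, sub_zero] at h1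

theorem Ideal.comap_le_of_le_comap {A : Type} [CommRing A] [IsNoetherianRing A] {f : A →+* A}
    (hf : Function.Surjective f) {I : Ideal A} (h : I ≤ I.comap f) : I.comap f ≤ I := by
  have hmono : Monotone fun m : ℕ => I.comap (f ^ m) := by
    refine monotone_nat_of_le_succ fun m x hx => ?_
    rw [Ideal.mem_comap, pow_succ', RingHom.mul_def, RingHom.comp_apply]
    exact h hx
  obtain ⟨N, hN⟩ := monotone_stabilizes_iff_noetherian.2 ‹IsNoetherianRing A› ⟨_, hmono⟩
  intro x hx
  have hsurj : Function.Surjective (f ^ N) := by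
    rw [RingHom.coe_pow]
    exact hf.iterate N
  obtain ⟨y, rfl⟩ := hsurj x
  have h1 : y ∈ I.comap (f ^ (N + 1)) := by
    rw [Ideal.mem_comap, pow_succ', RingHom.mul_def, RingHom.comp_apply]
    exact hx
  have h2 := hN (N + 1) N.le_succ
  change I.comap (f ^ N) = I.comap (f ^ (N + 1)) at h2
  rw [← h2] at h1
  exact h1

theorem exists_algEquiv_of_aeval_eq_zero_iff {K L₁ L₂ σ : Type} [Field K] [Field L₁] [Field L₂]
    [Algebra K L₁] [Algebra K L₂] {f₁ : σ → L₁} {f₂ : σ → L₂}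
    (h₁ : IntermediateField.adjoin K (Set.range f₁) = ⊤)
    (h₂ : IntermediateField.adjoin K (Set.range f₂) = ⊤)
    (h : ∀ P : MvPolynomial σ K, MvPolynomial.aeval f₁ P = 0 ↔ MvPolynomial.aeval f₂ P = 0) :
    ∃ φ : L₁ ≃ₐ[K] L₂, ∀ i, φ (f₁ i) = f₂ i := by
  let ev₁ : MvPolynomial σ K →ₐ[K] L₁ := MvPolynomial.aeval f₁
  let Q := MvPolynomial σ K ⧸ RingHom.ker ev₁
  let g₁ : Q →ₐ[K] L₁ := Ideal.kerLiftAlg ev₁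
  have hg₁ : Function.Injective g₁ := Ideal.kerLiftAlg_injective ev₁
  let g₂ : Q →ₐ[K] L₂ := Ideal.Quotient.liftₐ _ (MvPolynomial.aeval f₂) fun P hP => (h P).1 hP
  have hg₂ : Function.Injective g₂ := by
    rw [injective_iff_map_eq_zero]
    intro q hq
    obtain ⟨P, rfl⟩ := Ideal.Quotient.mk_surjective q
    exact Ideal.Quotient.eq_zero_iff_mem.2 ((h P).2 hq)
  let _ : Algebra Q L₁ := g₁.toRingHom.toAlgebra
  have : IsScalarTower K Q L₁ := IsScalarTower.of_algebraMap_eq fun r => (g₁.commutes r).symm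
  have : FaithfulSMul Q L₁ := (faithfulSMul_iff_algebraMap_injective _ _).2 hg₁
  have : IsFractionRing Q L₁ := IsFractionRing.of_field _ _ fun z => by
    have hz : z ∈ IntermediateField.adjoin K (Set.range f₁) := h₁ ▸ IntermediateField.mem_top
    obtain ⟨r, s, hrs⟩ := (IntermediateField.mem_adjoin_range_iff K f₁ z).1 hz
    exact ⟨Ideal.Quotient.mk _ r, Ideal.Quotient.mk _ s, hrs⟩
  let φ : L₁ →ₐ[K] L₂ := IsFractionRing.liftAlgHom hg₂
  have hφ : ∀ i, φ (f₁ i) = f₂ i := by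
    intro i
    have h1 : f₁ i = algebraMap Q L₁ (Ideal.Quotient.mk _ (MvPolynomial.X i)) :=
      (MvPolynomial.aeval_X f₁ i).symm
    rw [h1]
    exact (IsFractionRing.lift_algebraMap hg₂ _).trans (MvPolynomial.aeval_X f₂ i)
  have hsurj : Function.Surjective φ := by
    rw [← AlgHom.fieldRange_eq_top, ← top_le_iff, ← h₂, IntermediateField.adjoin_le_iff]
    rintro _ ⟨i, rfl⟩
    exact ⟨f₁ i, hφ i⟩
  exact ⟨AlgEquiv.ofBijective φ ⟨φ.injective, hsurj⟩, hφ⟩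

/-- The entries of a square matrix as a family. -/
abbrev Matrix.entries {L : Type} {n : ℕ} (M : Matrix (Fin n) (Fin n) L) :
    Fin n × Fin n → L :=
  fun q => M q.1 q.2

section Substitution

variable {K : Type} [Field K] {n : ℕ}

theorem MvPolynomial.algHom_aeval_entries {S T : Type} [CommRing S] [CommRing T] [Algebra K S]
    [Algebra K T] (φ : S →ₐ[K] T) (M : Matrix (Fin n) (Fin n) S)
    (P : MvPolynomial (Fin n × Fin n) K) :
    φ (MvPolynomial.aeval M.entries P) = MvPolynomial.aeval (M.map φ).entries P :=
  MvPolynomial.comp_aeval_apply M.entries φ P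

theorem MvPolynomial.aeval_det_mvPolynomialX {S : Type} [CommRing S] [Algebra K S]
    (M : Matrix (Fin n) (Fin n) S) :
    MvPolynomial.aeval M.entries (Matrix.mvPolynomialX (Fin n) (Fin n) K).det = M.det := by
  rw [AlgHom.map_det, Matrix.mvPolynomialX_mapMatrix_aeval]

/-- Substitution of `X * c` for the generic matrix `X`. -/
noncomputable def MvPolynomial.rightTranslate (c : Matrix (Fin n) (Fin n) K) :
    MvPolynomial (Fin n × Fin n) K →ₐ[K] MvPolynomial (Fin n × Fin n) K :=
  MvPolynomial.aeval (Matrix.mvPolynomialX (Fin n) (Fin n) K *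
    c.map (algebraMap K (MvPolynomial (Fin n × Fin n) K))).entries

theorem MvPolynomial.aeval_rightTranslate {S : Type} [CommRing S] [Algebra K S]
    (M : Matrix (Fin n) (Fin n) S) (c : Matrix (Fin n) (Fin n) K)
    (P : MvPolynomial (Fin n × Fin n) K) :
    MvPolynomial.aeval M.entries (MvPolynomial.rightTranslate c P) =
      MvPolynomial.aeval (M * c.map (algebraMap K S)).entries P := by
  have h1 : (Matrix.mvPolynomialX (Fin n) (Fin n) K).map (MvPolynomial.aeval M.entries) = M :=
    Matrix.mvPolynomialX_mapMatrix_aeval K M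
  have h2 : (c.map (algebraMap K (MvPolynomial (Fin n × Fin n) K))).map
      (MvPolynomial.aeval M.entries) = c.map (algebraMap K S) := by
    ext i j
    simp
  rw [MvPolynomial.rightTranslate, MvPolynomial.algHom_aeval_entries, Matrix.map_mul, h1, h2]

theorem MvPolynomial.rightTranslate_surjective {c : Matrix (Fin n) (Fin n) K} (hc : c.det ≠ 0) :
    Function.Surjective (MvPolynomial.rightTranslate c) := by
  intro P
  refine ⟨MvPolynomial.rightTranslate c⁻¹ P, ?_⟩
  conv_lhs => rw [MvPolynomial.rightTranslate]
  rw [MvPolynomial.aeval_rightTranslate, Matrix.mul_assoc, ← Matrix.map_mul,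
    Matrix.mul_nonsing_inv _ hc.isUnit, Matrix.map_one _ (map_zero _) (map_one _), mul_one]
  exact MvPolynomial.aeval_X_left_apply P

end Substitution

section Derivatives

variable {L σ : Type} [Field L]

theorem FieldDeriv.coeff_add_deriv (d : FieldDeriv L) {p p' q q' : MvPolynomial σ L}
    (hp : ∀ m, p'.coeff m = d.d (p.coeff m)) (hq : ∀ m, q'.coeff m = d.d (q.coeff m)) :
    ∀ m, (p' + q').coeff m = d.d ((p + q).coeff m) := fun m => by
  rw [MvPolynomial.coeff_add, MvPolynomial.coeff_add, d.map_add, hp, hq]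

theorem FieldDeriv.coeff_sum_deriv (d : FieldDeriv L) {ι : Type} (s : Finset ι)
    {p p' : ι → MvPolynomial σ L} (hp : ∀ i m, (p' i).coeff m = d.d ((p i).coeff m)) :
    ∀ m, (∑ i ∈ s, p' i).coeff m = d.d ((∑ i ∈ s, p i).coeff m) := fun m => by
  rw [MvPolynomial.coeff_sum, MvPolynomial.coeff_sum, ← d.toDerivation_apply, map_sum]
  exact Finset.sum_congr rfl fun i _ => hp i m

theorem FieldDeriv.coeff_mul_deriv (d : FieldDeriv L) {p p' q q' : MvPolynomial σ L}
    (hp : ∀ m, p'.coeff m = d.d (p.coeff m)) (hq : ∀ m, q'.coeff m = d.d (q.coeff m)) :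
    ∀ m, (p * q' + p' * q).coeff m = d.d ((p * q).coeff m) := fun m => by
  classical
  rw [MvPolynomial.coeff_add, MvPolynomial.coeff_mul, MvPolynomial.coeff_mul,
    MvPolynomial.coeff_mul, ← d.toDerivation_apply, map_sum, ← Finset.sum_add_distrib]
  exact Finset.sum_congr rfl fun i _ => by rw [hq, hp, d.toDerivation_apply, d.leibniz]

theorem FieldDeriv.coeff_C_deriv (d : FieldDeriv L) (a : L) :
    ∀ m, (MvPolynomial.C (σ := σ) (d.d a)).coeff m = d.d ((MvPolynomial.C (σ := σ) a).coeff m) :=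
  fun m => by
  classical
  rw [MvPolynomial.coeff_C, MvPolynomial.coeff_C]
  split_ifs
  · rfl
  · exact (map_zero d.toDerivation).symm

theorem FieldDeriv.coeff_C_mul_X_deriv (d : FieldDeriv L) (a : L) (i : σ) :
    ∀ m, (MvPolynomial.C (d.d a) * MvPolynomial.X i).coeff m =
      d.d ((MvPolynomial.C a * MvPolynomial.X i).coeff m) := fun m => by
  classical
  rw [MvPolynomial.coeff_C_mul, MvPolynomial.coeff_C_mul, MvPolynomial.coeff_X]
  split_ifs
  · rw [mul_one, mul_one]
  · rw [mul_zero, mul_zero]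
    exact (map_zero d.toDerivation).symm

theorem FieldDeriv.exists_coeff_deriv (d : FieldDeriv L) (p : MvPolynomial σ L) :
    ∃ p' : MvPolynomial σ L, ∀ m, p'.coeff m = d.d (p.coeff m) := by
  induction p using MvPolynomial.induction_on with
  | C a => exact ⟨_, d.coeff_C_deriv a⟩
  | add p q hp hq =>
    obtain ⟨p', hp⟩ := hp
    obtain ⟨q', hq⟩ := hq
    exact ⟨_, d.coeff_add_deriv hp hq⟩
  | mul_X p i hp =>
    obtain ⟨p', hp⟩ := hp
    have h1 := d.coeff_C_mul_X_deriv (1 : L) i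
    rw [MvPolynomial.C_1, one_mul] at h1
    exact ⟨_, d.coeff_mul_deriv hp h1⟩

/-- An ideal generated by a differentially stable set is differentially stable. -/
theorem FieldDeriv.exists_coeff_deriv_mem_span (d : FieldDeriv L) {S : Set (MvPolynomial σ L)}
    (hS : ∀ u ∈ S, ∃ u' ∈ S, ∀ m, u'.coeff m = d.d (u.coeff m)) :
    ∀ u ∈ Ideal.span S, ∃ u' ∈ Ideal.span S, ∀ m, u'.coeff m = d.d (u.coeff m) := by
  intro u hu
  induction hu using Submodule.span_induction with
  | mem u hu =>
    obtain ⟨u', hu', h⟩ := hS u hu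
    exact ⟨u', Ideal.subset_span hu', h⟩
  | zero =>
    refine ⟨0, zero_mem _, fun m => ?_⟩
    rw [MvPolynomial.coeff_zero]
    exact (map_zero d.toDerivation).symm
  | add u v _ _ hu hv =>
    obtain ⟨u', hu', hu⟩ := hu
    obtain ⟨v', hv', hv⟩ := hv
    exact ⟨_, add_mem hu' hv', d.coeff_add_deriv hu hv⟩
  | smul a u hu hu' =>
    obtain ⟨u', hu', h⟩ := hu'
    obtain ⟨a', ha⟩ := d.exists_coeff_deriv a
    exact ⟨_, add_mem (Ideal.mul_mem_left _ a hu') (Ideal.mul_mem_left _ a' hu),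
      d.coeff_mul_deriv ha h⟩

end Derivatives

section Solutions

variable {K L₁ L₂ : Type} [Field K] [Field L₁] [Field L₂] [Algebra K L₁] [Algebra K L₂] {n : ℕ}

/-- The derivation on `K[X]` with `X' = A X` induces the derivation of `L₂` under `X ↦ F₂` and
the coefficientwise derivation of `L₁[Y]` under `X ↦ F₁ Y`. -/
theorem exists_aeval_deriv (dK : FieldDeriv K) (d₁ : FieldDeriv L₁) (d₂ : FieldDeriv L₂)
    (hd₁ : ∀ a, d₁.d (algebraMap K L₁ a) = algebraMap K L₁ (dK.d a))
    (hd₂ : ∀ a, d₂.d (algebraMap K L₂ a) = algebraMap K L₂ (dK.d a))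
    {A : Matrix (Fin n) (Fin n) K} {F₁ : Matrix (Fin n) (Fin n) L₁}
    {F₂ : Matrix (Fin n) (Fin n) L₂}
    (hF₁ : ∀ i j, d₁.d (F₁ i j) = (A.map (algebraMap K L₁) * F₁) i j)
    (hF₂ : ∀ i j, d₂.d (F₂ i j) = (A.map (algebraMap K L₂) * F₂) i j)
    (P : MvPolynomial (Fin n × Fin n) K) :
    ∃ P' : MvPolynomial (Fin n × Fin n) K,
      d₂.d (MvPolynomial.aeval F₂.entries P) = MvPolynomial.aeval F₂.entries P' ∧
      ∀ m, (MvPolynomial.aeval (F₁.map (MvPolynomial.C (σ := Fin n × Fin n)) *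
          Matrix.mvPolynomialX (Fin n) (Fin n) L₁).entries P').coeff m =
        d₁.d ((MvPolynomial.aeval (F₁.map (MvPolynomial.C (σ := Fin n × Fin n)) *
          Matrix.mvPolynomialX (Fin n) (Fin n) L₁).entries P).coeff m) := by
  induction P using MvPolynomial.induction_on with
  | C a =>
    refine ⟨MvPolynomial.C (dK.d a), ?_, ?_⟩
    · simp [hd₂]
    · rw [MvPolynomial.aeval_C, MvPolynomial.aeval_C, MvPolynomial.algebraMap_apply,
        MvPolynomial.algebraMap_apply, ← hd₁]
      exact d₁.coeff_C_deriv _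
  | add p q hp hq =>
    obtain ⟨p', hp, hp'⟩ := hp
    obtain ⟨q', hq, hq'⟩ := hq
    refine ⟨p' + q', ?_, ?_⟩
    · rw [map_add, d₂.map_add, hp, hq, map_add]
    · rw [map_add, map_add]
      exact d₁.coeff_add_deriv hp' hq'
  | mul_X p i hp =>
    obtain ⟨p', hp, hp'⟩ := hp
    refine ⟨p * ∑ l, MvPolynomial.C (A i.1 l) * MvPolynomial.X (l, i.2) + p' * MvPolynomial.X i,
      ?_, ?_⟩
    · rw [map_mul, d₂.leibniz, hp, MvPolynomial.aeval_X, hF₂, map_add, map_mul, map_mul,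
        MvPolynomial.aeval_X, Matrix.mul_apply, map_sum]
      congr 2
      exact Finset.sum_congr rfl fun l _ => by simp
    · simp only [map_add, map_mul]
      refine d₁.coeff_mul_deriv hp' ?_
      have h1 := d₁.coeff_sum_deriv Finset.univ fun l =>
        d₁.coeff_C_mul_X_deriv (F₁ i.1 l) ((l, i.2) : Fin n × Fin n)
      convert h1 using 3
      · simp only [map_sum, map_mul, MvPolynomial.aeval_C, MvPolynomial.aeval_X, hF₁,
          Matrix.mul_apply, Matrix.map_apply, Matrix.mvPolynomialX_apply,
          MvPolynomial.algebraMap_apply, Finset.mul_sum, Finset.sum_mul]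
        rw [Finset.sum_comm]
        simp only [mul_assoc]
      · simp [Matrix.mul_apply]

theorem exists_constant_matrix [CharZero K] (hK : IsRealClosedField K) {dK : FieldDeriv K}
    {d₁ : FieldDeriv L₁} {d₂ : FieldDeriv L₂}
    (hd₁ : ∀ a, d₁.d (algebraMap K L₁ a) = algebraMap K L₁ (dK.d a))
    (hd₂ : ∀ a, d₂.d (algebraMap K L₂ a) = algebraMap K L₂ (dK.d a))
    {A : Matrix (Fin n) (Fin n) K} {F₁ : Matrix (Fin n) (Fin n) L₁}
    {F₂ : Matrix (Fin n) (Fin n) L₂}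
    (hF₁ : ∀ i j, d₁.d (F₁ i j) = (A.map (algebraMap K L₁) * F₁) i j)
    (hF₂ : ∀ i j, d₂.d (F₂ i j) = (A.map (algebraMap K L₂) * F₂) i j)
    (hF₁0 : F₁.det ≠ 0) (hF₂0 : F₂.det ≠ 0)
    (hconst : ∀ x, d₁.d x = 0 → ∃ a : K, dK.d a = 0 ∧ algebraMap K L₁ a = x)
    (hL₁ : IsFormallyRealField L₁) (hL₂ : IsFormallyRealField L₂) :
    ∃ c : Matrix (Fin n) (Fin n) K, c.det ≠ 0 ∧ (∀ i j, dK.d (c i j) = 0) ∧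
      ∀ P : MvPolynomial (Fin n × Fin n) K, MvPolynomial.aeval F₂.entries P = 0 →
        MvPolynomial.aeval (F₁ * c.map (algebraMap K L₁)).entries P = 0 := by
  obtain ⟨R₁, _, _, hR₁⟩ := hL₁.exists_isRealClosedField
  obtain ⟨R₂, _, _, hR₂⟩ := hL₂.exists_isRealClosedField
  obtain ⟨_, _⟩ := hR₁.exists_linearOrder
  obtain ⟨_, _⟩ := hR₂.exists_linearOrder
  let _ : Algebra K R₁ := ((algebraMap L₁ R₁).comp (algebraMap K L₁)).toAlgebra
  let _ : Algebra K R₂ := ((algebraMap L₂ R₂).comp (algebraMap K L₂)).toAlgebra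
  have : IsScalarTower K L₁ R₁ := IsScalarTower.of_algebraMap_eq fun _ => rfl
  have : IsScalarTower K L₂ R₂ := IsScalarTower.of_algebraMap_eq fun _ => rfl
  obtain ⟨a, ha0, ha⟩ : ∃ a : Matrix (Fin n) (Fin n) K, a.det ≠ 0 ∧
      ∀ P, MvPolynomial.aeval F₂.entries P = 0 → MvPolynomial.eval a.entries P = 0 := by
    obtain ⟨a, ha0, ha⟩ := hR₂.exists_point (fun z hz => hK.mem_range_of_isAlgebraic hR₂.1 hz)
      (F₂.map (algebraMap L₂ R₂)).entries (Matrix.mvPolynomialX (Fin n) (Fin n) K).det (by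
        rw [MvPolynomial.aeval_det_mvPolynomialX, ← RingHom.mapMatrix_apply, ← RingHom.map_det]
        exact (map_ne_zero_iff _ (algebraMap L₂ R₂).injective).2 hF₂0)
    refine ⟨Matrix.of fun i j => a (i, j), ?_, fun P hP => ha P ?_⟩
    · rwa [← Matrix.eval_det_mvPolynomialX]
    · have h1 := MvPolynomial.algHom_aeval_entries (IsScalarTower.toAlgHom K L₂ R₂) F₂ P
      rw [hP, map_zero] at h1
      exact h1.symm
  let C₁ : Matrix (Fin n) (Fin n) L₁ := F₁⁻¹ * a.map (algebraMap K L₁)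
  have hC₁ : C₁.det ≠ 0 := by
    rw [Matrix.det_mul, ← RingHom.mapMatrix_apply, ← RingHom.map_det, Matrix.det_nonsing_inv,
      Ring.inverse_eq_inv]
    exact mul_ne_zero (inv_ne_zero hF₁0) ((map_ne_zero_iff _ (algebraMap K L₁).injective).2 ha0)
  let k := dK.constants
  obtain ⟨c, hc0, hc⟩ : ∃ c : Matrix (Fin n) (Fin n) k, c.det ≠ 0 ∧
      ∀ P : MvPolynomial (Fin n × Fin n) k, MvPolynomial.aeval C₁.entries P = 0 →
        MvPolynomial.eval c.entries P = 0 := by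
    obtain ⟨c, hc0, hc⟩ := hR₁.exists_point
      (fun z hz => hK.mem_range_constants_of_isAlgebraic hR₁.1 dK hz)
      (C₁.map (algebraMap L₁ R₁)).entries (Matrix.mvPolynomialX (Fin n) (Fin n) k).det (by
        rw [MvPolynomial.aeval_det_mvPolynomialX, ← RingHom.mapMatrix_apply, ← RingHom.map_det]
        exact (map_ne_zero_iff _ (algebraMap L₁ R₁).injective).2 hC₁)
    refine ⟨Matrix.of fun i j => c (i, j), ?_, fun P hP => hc P ?_⟩
    · rwa [← Matrix.eval_det_mvPolynomialX]
    · have h1 := MvPolynomial.algHom_aeval_entries (IsScalarTower.toAlgHom k L₁ R₁) C₁ P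
      rw [hP, map_zero] at h1
      exact h1.symm
  let c' : Matrix (Fin n) (Fin n) K := c.map (algebraMap k K)
  let Y := F₁.map (MvPolynomial.C (σ := Fin n × Fin n)) * Matrix.mvPolynomialX (Fin n) (Fin n) L₁
  have hY : ∀ (M : Matrix (Fin n) (Fin n) L₁) (P : MvPolynomial (Fin n × Fin n) K),
      MvPolynomial.aeval M.entries (MvPolynomial.aeval Y.entries P) =
        MvPolynomial.aeval (F₁ * M).entries P := by
    intro M P
    have h1 : Y.map (MvPolynomial.aeval (R := L₁) M.entries) = F₁ * M := by
      rw [Matrix.map_mul]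
      congr 1
      · ext i j
        simp
      · exact Matrix.mvPolynomialX_mapMatrix_aeval L₁ M
    rw [← h1]
    exact MvPolynomial.algHom_aeval_entries
      ((MvPolynomial.aeval (R := L₁) M.entries).restrictScalars K) Y P
  let S : Set (MvPolynomial (Fin n × Fin n) L₁) :=
    (fun P : MvPolynomial (Fin n × Fin n) K => MvPolynomial.aeval Y.entries P) ''
      {P | MvPolynomial.aeval F₂.entries P = 0}
  have hS : ∀ u ∈ S, ∃ u' ∈ S, ∀ m, u'.coeff m = d₁.d (u.coeff m) := by
    rintro _ ⟨P, hP, rfl⟩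
    obtain ⟨P', h1, h2⟩ := exists_aeval_deriv dK d₁ d₂ hd₁ hd₂ hF₁ hF₂ P
    refine ⟨_, ⟨P', ?_, rfl⟩, h2⟩
    rw [Set.mem_ofPred_eq] at hP ⊢
    rw [← h1, hP]
    exact map_zero d₂.toDerivation
  have hSC : ∀ u ∈ Ideal.span S, MvPolynomial.aeval C₁.entries u = 0 := by
    have h1 : Ideal.span S ≤ RingHom.ker (MvPolynomial.aeval (R := L₁) C₁.entries) := by
      rw [Ideal.span_le]
      rintro _ ⟨P, hP, rfl⟩
      refine (hY C₁ P).trans ?_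
      have h2 : F₁ * C₁ = a.map (algebraMap K L₁) :=
        Matrix.mul_nonsing_inv_cancel_left _ _ hF₁0.isUnit
      rw [h2]
      have h3 := MvPolynomial.algHom_aeval_entries (Algebra.ofId K L₁) a P
      have h4 : MvPolynomial.aeval a.entries P = 0 := ha P hP
      rw [h4, map_zero] at h3
      exact h3.symm
    exact fun u hu => h1 hu
  have hmain := d₁.toDerivation.eq_zero_of_forall_coeff_eq_zero
    (J := (Ideal.span S).restrictScalars L₁) (d₁.exists_coeff_deriv_mem_span hS)
    (MvPolynomial.aeval (R := L₁) (c'.map (algebraMap K L₁)).entries).toLinearMap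
    fun u hu hcoef => by
      have h1 : u ∈ Set.range (MvPolynomial.map (σ := Fin n × Fin n) (algebraMap k L₁)) := by
        rw [MvPolynomial.mem_range_map_iff_coeffs_subset]
        intro z hz
        obtain ⟨m, -, rfl⟩ := MvPolynomial.mem_coeffs_iff.1 hz
        obtain ⟨b, hb, hbz⟩ := hconst _ (hcoef m)
        exact ⟨⟨b, hb⟩, hbz⟩
      obtain ⟨P, rfl⟩ := h1
      have h2 := hSC _ hu
      rw [MvPolynomial.aeval_map_algebraMap] at h2
      have h3 : MvPolynomial.aeval c.entries P = 0 := hc P h2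
      have h4 := MvPolynomial.algHom_aeval_entries (Algebra.ofId k L₁) c P
      rw [h3, map_zero] at h4
      rw [AlgHom.toLinearMap_apply, MvPolynomial.aeval_map_algebraMap]
      exact h4.symm
  refine ⟨c', ?_, fun i j => (c i j).2, fun P hP => ?_⟩
  · change ((algebraMap k K).mapMatrix c).det ≠ 0
    rw [← RingHom.map_det]
    exact (map_ne_zero_iff _ (algebraMap k K).injective).2 hc0
  · rw [← hY]
    exact hmain _ (Ideal.subset_span ⟨P, hP, rfl⟩)

end Solutions

theorem adjoin_entries_mul_eq_top {K L : Type} [Field K] [Field L] [Algebra K L] {n : ℕ}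
    {F : Matrix (Fin n) (Fin n) L} {c : Matrix (Fin n) (Fin n) K} (hc : c.det ≠ 0)
    (h : IntermediateField.adjoin K (Set.range F.entries) = ⊤) :
    IntermediateField.adjoin K (Set.range (F * c.map (algebraMap K L)).entries) = ⊤ := by
  rw [← top_le_iff, ← h, IntermediateField.adjoin_le_iff]
  rintro _ ⟨q, rfl⟩
  have h1 : F = F * c.map (algebraMap K L) * c⁻¹.map (algebraMap K L) := by
    rw [Matrix.mul_assoc, ← Matrix.map_mul, Matrix.mul_nonsing_inv _ hc.isUnit,
      Matrix.map_one _ (map_zero _) (map_one _), mul_one]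
  have h2 : F.entries q =
      ∑ l, (F * c.map (algebraMap K L)) q.1 l * algebraMap K L (c⁻¹ l q.2) :=
    congrFun (congrFun h1 q.1) q.2
  rw [h2]
  exact sum_mem fun l _ => mul_mem
    (IntermediateField.subset_adjoin _ _ ⟨(q.1, l), rfl⟩) (IntermediateField.algebraMap_mem _ _)

theorem AlgEquiv.comp_deriv_of_adjoin_eq_top {K L₁ L₂ σ : Type} [Field K] [Field L₁] [Field L₂]
    [Algebra K L₁] [Algebra K L₂] {dK : FieldDeriv K} {d₁ : FieldDeriv L₁} {d₂ : FieldDeriv L₂}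
    (hd₁ : ∀ a, d₁.d (algebraMap K L₁ a) = algebraMap K L₁ (dK.d a))
    (hd₂ : ∀ a, d₂.d (algebraMap K L₂ a) = algebraMap K L₂ (dK.d a))
    {f : σ → L₁} (h : IntermediateField.adjoin K (Set.range f) = ⊤) (φ : L₁ ≃ₐ[K] L₂)
    (hφ : ∀ i, φ (d₁.d (f i)) = d₂.d (φ (f i))) (x : L₁) : φ (d₁.d x) = d₂.d (φ x) := by
  have hx : x ∈ IntermediateField.adjoin K (Set.range f) := h ▸ IntermediateField.mem_top
  induction hx using IntermediateField.adjoin_induction with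
  | mem x hx =>
    obtain ⟨i, rfl⟩ := hx
    exact hφ i
  | algebraMap a => rw [hd₁, φ.commutes, φ.commutes, hd₂]
  | add x y _ _ hx hy => rw [d₁.map_add, _root_.map_add, _root_.map_add, d₂.map_add, hx, hy]
  | inv x _ hx =>
    rw [map_inv₀, ← d₁.toDerivation_apply, ← d₂.toDerivation_apply, Derivation.leibniz_inv,
      Derivation.leibniz_inv, d₁.toDerivation_apply, d₂.toDerivation_apply, smul_eq_mul,
      smul_eq_mul, _root_.map_mul, hx, _root_.map_neg, _root_.map_pow, map_inv₀]
  | mul x y _ _ hx hy =>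
    rw [d₁.leibniz, _root_.map_add, _root_.map_mul, _root_.map_mul, _root_.map_mul, d₂.leibniz,
      hx, hy]

theorem FieldDeriv.deriv_mul_constant {K L : Type} [Field K] [Field L] [Algebra K L] {n : ℕ}
    {dK : FieldDeriv K} {d : FieldDeriv L}
    (hd : ∀ a, d.d (algebraMap K L a) = algebraMap K L (dK.d a))
    {A : Matrix (Fin n) (Fin n) K} {F : Matrix (Fin n) (Fin n) L}
    (hF : ∀ i j, d.d (F i j) = (A.map (algebraMap K L) * F) i j)
    {c : Matrix (Fin n) (Fin n) K} (hc : ∀ i j, dK.d (c i j) = 0) (i j : Fin n) :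
    d.d ((F * c.map (algebraMap K L)) i j) =
      (A.map (algebraMap K L) * (F * c.map (algebraMap K L))) i j := by
  rw [← Matrix.mul_assoc, Matrix.mul_apply, Matrix.mul_apply, ← d.toDerivation_apply, map_sum]
  refine Finset.sum_congr rfl fun l _ => ?_
  rw [d.toDerivation_apply, d.leibniz, Matrix.map_apply, hd, hc, map_zero, mul_zero, zero_add, hF]

end

/-- Over a real closed differential field `K` (with field of constants
`k ≠ K`), any two real Picard--Vessiot fields for `y' = A y` are isomorphic as
differential field extensions of `K`. -/
theorem real_picard_vessiot_unique_over_real_closed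
    (K : Type) [Field K] [CharZero K] (dK : FieldDeriv K)
    (hKrc : IsRealClosedField K)
    (hkK : ∃ a : K, dK.d a ≠ 0)
    (n : ℕ) (A : Matrix (Fin n) (Fin n) K)
    (L₁ L₂ : Type) [Field L₁] [Field L₂] [Algebra K L₁] [Algebra K L₂]
    (d₁ : FieldDeriv L₁) (d₂ : FieldDeriv L₂)
    (hPV₁ : IsPicardVessiot dK d₁ A) (hreal₁ : IsFormallyRealField L₁)
    (hPV₂ : IsPicardVessiot dK d₂ A) (hreal₂ : IsFormallyRealField L₂) :
    ∃ φ : L₁ ≃ₐ[K] L₂, ∀ x : L₁, φ (d₁.d x) = d₂.d (φ x) := by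
  obtain ⟨hd₁, F₁, hu₁, hF₁, htop₁, hconst₁⟩ := hPV₁
  obtain ⟨hd₂, F₂, hu₂, hF₂, htop₂, hconst₂⟩ := hPV₂
  obtain ⟨c, hc0, hcd, hc⟩ := exists_constant_matrix hKrc hd₁ hd₂ hF₁ hF₂ hu₁.ne_zero hu₂.ne_zero
    hconst₁ hreal₁ hreal₂
  obtain ⟨e, he0, -, he⟩ := exists_constant_matrix hKrc hd₂ hd₁ hF₂ hF₁ hu₂.ne_zero hu₁.ne_zero
    hconst₂ hreal₂ hreal₁
  have hle : RingHom.ker (MvPolynomial.aeval (R := K) F₂.entries) ≤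
      (RingHom.ker (MvPolynomial.aeval (R := K) F₂.entries)).comap
        ((MvPolynomial.rightTranslate e).comp (MvPolynomial.rightTranslate c)).toRingHom := by
    intro P hP
    change MvPolynomial.aeval F₂.entries
      (MvPolynomial.rightTranslate e (MvPolynomial.rightTranslate c P)) = 0
    rw [MvPolynomial.aeval_rightTranslate]
    apply he
    rw [MvPolynomial.aeval_rightTranslate]
    exact hc P hP
  have hsurj : Function.Surjective
      (MvPolynomial.rightTranslate e ∘ MvPolynomial.rightTranslate c) :=
    (MvPolynomial.rightTranslate_surjective he0).comp (MvPolynomial.rightTranslate_surjective hc0)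
  have hge := Ideal.comap_le_of_le_comap hsurj hle
  obtain ⟨φ, hφ⟩ := exists_algEquiv_of_aeval_eq_zero_iff (adjoin_entries_mul_eq_top hc0 htop₁)
    htop₂ fun P => ⟨fun hP => hge (by
      change MvPolynomial.aeval F₂.entries
        (MvPolynomial.rightTranslate e (MvPolynomial.rightTranslate c P)) = 0
      rw [MvPolynomial.aeval_rightTranslate]
      apply he
      rwa [MvPolynomial.aeval_rightTranslate]), hc P⟩
  refine ⟨φ, φ.comp_deriv_of_adjoin_eq_top hd₁ hd₂ (adjoin_entries_mul_eq_top hc0 htop₁) ?_⟩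
  rintro ⟨i, j⟩
  have h1 : ∀ i j, φ ((F₁ * c.map (algebraMap K L₁)) i j) = F₂ i j := fun i j => hφ (i, j)
  change φ (d₁.d ((F₁ * c.map (algebraMap K L₁)) i j)) =
    d₂.d (φ ((F₁ * c.map (algebraMap K L₁)) i j))
  rw [FieldDeriv.deriv_mul_constant hd₁ hF₁ hcd, h1, hF₂, Matrix.mul_apply, Matrix.mul_apply,
    map_sum]
  refine Finset.sum_congr rfl fun l _ => ?_
  rw [_root_.map_mul, h1, Matrix.map_apply, Matrix.map_apply, φ.commutes]
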